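/- arXiv:1004.5304 — 3 statements merged into one kernel-verified Lean document; each statement's English description precedes it below -/
import Mathlib

section
/- Let n ≥ 2, let Ω be a proper subdomain of ℝⁿ and let x₀ ∈ Ω. Then Ω is a weak carrot domain if and only if there exists a constant σ > 0 such that ∫_Ω exp(σ k_Ω(x₀, x)) dx < ∞. -/
open MeasureTheory Metric Set
open scoped ENNReal

noncomputable section

/-- Euclidean space `ℝⁿ`. -/
abbrev Eu (n : ℕ) : Type := EuclideanSpace ℝ (Fin n)

/-- A domain: a nonempty open connected subset. -/
def IsDomainEu {n : ℕ} (Ω : Set (Eu n)) : Prop := IsOpen Ω ∧ IsConnected Ω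

/-- The Hajłasz gradient class `𝒟^{s,ρ}_ball(u)` on `Ω`: nonnegative measurable `g` such that
`|u x - u y| ≤ |x-y|^s (g x + g y)` for all `x, y ∈ Ω` off a null set with
`|x - y| < ρ · dist(x, ∂Ω)`. -/
def DBall {n : ℕ} (Ω : Set (Eu n)) (s ρ : ℝ) (u : Eu n → ℝ) : Set (Eu n → ℝ) :=
  {g | Measurable g ∧ (∀ x, 0 ≤ g x) ∧
    ∃ N : Set (Eu n), N ⊆ Ω ∧ volume N = 0 ∧
      ∀ x ∈ Ω \ N, ∀ y ∈ Ω \ N,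
        edist x y < ENNReal.ofReal ρ * EMetric.infEdist x Ωᶜ →
        |u x - u y| ≤ dist x y ^ s * (g x + g y)}

/-- The full Hajłasz gradient class `𝒟^s(u)` on `U`. -/
def DFull {n : ℕ} (U : Set (Eu n)) (s : ℝ) (u : Eu n → ℝ) : Set (Eu n → ℝ) :=
  {g | Measurable g ∧ (∀ x, 0 ≤ g x) ∧
    ∃ N : Set (Eu n), N ⊆ U ∧ volume N = 0 ∧
      ∀ x ∈ U \ N, ∀ y ∈ U \ N, |u x - u y| ≤ dist x y ^ s * (g x + g y)}

/-- `inf_{g ∈ 𝒟^{s,ρ}_ball(u)} ‖g‖_{L^p(Ω)}`. -/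
def ballNormRho {n : ℕ} (Ω : Set (Eu n)) (s p ρ : ℝ) (u : Eu n → ℝ) : ℝ≥0∞ :=
  ⨅ g ∈ DBall Ω s ρ u, eLpNorm g (ENNReal.ofReal p) (volume.restrict Ω)

/-- The `Ṁ^{s,p}_ball(Ω)` seminorm (with `ρ = 1/2`). -/
def ballNorm {n : ℕ} (Ω : Set (Eu n)) (s p : ℝ) (u : Eu n → ℝ) : ℝ≥0∞ :=
  ballNormRho Ω s p (1/2) u

/-- The `Ṁ^{s,p}(U)` seminorm. -/
def fullNorm {n : ℕ} (U : Set (Eu n)) (s p : ℝ) (u : Eu n → ℝ) : ℝ≥0∞ :=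
  ⨅ g ∈ DFull U s u, eLpNorm g (ENNReal.ofReal p) (volume.restrict U)

/-- Membership in `Ṁ^{s,p}_ball(Ω)`. -/
def MemMball {n : ℕ} (Ω : Set (Eu n)) (s p : ℝ) (u : Eu n → ℝ) : Prop :=
  Measurable u ∧ ballNorm Ω s p u < ⊤

/-- Membership in `Ṁ^{s,p}(U)`. -/
def MemMfull {n : ℕ} (U : Set (Eu n)) (s p : ℝ) (u : Eu n → ℝ) : Prop :=
  Measurable u ∧ fullNorm U s p u < ⊤

/-- `Ω` supports a `(pn/(n-ps), p)_s`-Hajłasz–Sobolev–Poincaré imbedding. -/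
def SupportsHSP {n : ℕ} (Ω : Set (Eu n)) (s p : ℝ) : Prop :=
  ∃ C : ℝ, 0 < C ∧ ∀ u : Eu n → ℝ, MemMball Ω s p u →
    eLpNorm (fun x => u x - ⨍ y in Ω, u y)
        (ENNReal.ofReal (p * n / (n - p * s))) (volume.restrict Ω)
      ≤ ENNReal.ofReal C * ballNorm Ω s p u

/-- LLC(2) with constant `b`: points of `Ω \ B(z,r)` lie in the same connected component
of `Ω \ B(z, br)`. -/
def LLC2With {n : ℕ} (Ω : Set (Eu n)) (b : ℝ) : Prop :=
  ∀ (z : Eu n) (r : ℝ), 0 < r →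
    ∀ x ∈ Ω \ ball z r, ∀ y ∈ Ω \ ball z r,
      y ∈ connectedComponentIn (Ω \ ball z (b * r)) x

/-- The LLC(2) property. -/
def LLC2 {n : ℕ} (Ω : Set (Eu n)) : Prop :=
  ∃ b : ℝ, b ∈ Set.Ioo (0:ℝ) 1 ∧ LLC2With Ω b

/-- `Ω` is an `Ṁ^{s,p}_ball`-extension domain. -/
def IsMballExtensionDomain {n : ℕ} (Ω : Set (Eu n)) (s p : ℝ) : Prop :=
  ∃ C : ℝ, 0 < C ∧ ∀ u : Eu n → ℝ, MemMball Ω s p u →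
    ∃ v : Eu n → ℝ, MemMball (Set.univ) s p v ∧ (∀ x ∈ Ω, v x = u x) ∧
      ballNorm (Set.univ) s p v ≤ ENNReal.ofReal C * ballNorm Ω s p u

/-- `Ω` is a John domain: there are `x₀ ∈ Ω` and `C > 0` such that every `x ∈ Ω` is joined to
`x₀` by a curve parametrized by arclength (here: `1`-Lipschitz) with
`dist(γ t, Ωᶜ) ≥ C t`. -/
def IsJohnDomain {n : ℕ} (Ω : Set (Eu n)) : Prop :=
  ∃ x₀ ∈ Ω, ∃ C : ℝ, 0 < C ∧ ∀ x ∈ Ω, ∃ ℓ : ℝ, 0 ≤ ℓ ∧ ∃ γ : ℝ → Eu n,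
    LipschitzOnWith 1 γ (Set.Icc 0 ℓ) ∧ γ 0 = x ∧ γ ℓ = x₀ ∧
    ∀ t ∈ Set.Icc (0:ℝ) ℓ, γ t ∈ Ω ∧ C * t ≤ infDist (γ t) Ωᶜ

/-- Quasihyperbolic distance: infimum over arclength-parametrized (`1`-Lipschitz) curves in `Ω`
joining `x` to `y` of `∫ dist(γ t, Ωᶜ)⁻¹ dt`. -/
def qhDist {n : ℕ} (Ω : Set (Eu n)) (x y : Eu n) : ℝ :=
  sInf { k : ℝ | ∃ ℓ : ℝ, 0 ≤ ℓ ∧ ∃ γ : ℝ → Eu n,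
    LipschitzOnWith 1 γ (Set.Icc 0 ℓ) ∧ γ 0 = x ∧ γ ℓ = y ∧
    (∀ t ∈ Set.Icc (0:ℝ) ℓ, γ t ∈ Ω) ∧
    k = ∫ t in (0:ℝ)..ℓ, (infDist (γ t) Ωᶜ)⁻¹ }

/-- Weak carrot domain (quasihyperbolic boundary condition). -/
def IsWeakCarrot {n : ℕ} (Ω : Set (Eu n)) : Prop :=
  ∃ x₀ ∈ Ω, ∃ C : ℝ, 1 ≤ C ∧ ∀ x ∈ Ω,
    qhDist Ω x x₀ ≤ C * Real.log (C / infDist x Ωᶜ)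

/-- The Luxemburg norm `‖u‖_{φ_s(L)(Ω)}` with `φ_s(t) = exp(t^{n/(n-s)}) - 1`
(value `⊤` when no admissible `t` exists). -/
def phiLux {n : ℕ} (Ω : Set (Eu n)) (s : ℝ) (u : Eu n → ℝ) : ℝ≥0∞ :=
  sInf (ENNReal.ofReal '' { t : ℝ | 0 < t ∧
    (∫⁻ x in Ω, ENNReal.ofReal
        (Real.exp ((|u x| / t) ^ ((n : ℝ) / ((n : ℝ) - s))) - 1)) ≤ 1 })

/-- `Ω` supports an `s`-Hajłasz–Trudinger imbedding. -/
def SupportsHT {n : ℕ} (Ω : Set (Eu n)) (s : ℝ) : Prop :=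
  ∃ C : ℝ, 0 < C ∧ ∀ u : Eu n → ℝ, MemMball Ω s ((n : ℝ) / s) u →
    phiLux Ω s (fun x => u x - ⨍ y in Ω, u y)
      ≤ ENNReal.ofReal C * ballNorm Ω s ((n : ℝ) / s) u

/-- The separation property with respect to `x₀` and `C`. -/
def SeparationProperty {n : ℕ} (Ω : Set (Eu n)) (x₀ : Eu n) (C : ℝ) : Prop :=
  ∀ x ∈ Ω, ∃ γ : ℝ → Eu n, ContinuousOn γ (Set.Icc 0 1) ∧
    (∀ t ∈ Set.Icc (0:ℝ) 1, γ t ∈ Ω) ∧ γ 0 = x ∧ γ 1 = x₀ ∧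
    ∀ t ∈ Set.Ioc (0:ℝ) 1,
      γ '' Set.Icc 0 t ⊆ ball (γ t) (C * infDist (γ t) Ωᶜ) ∨
      ∀ y ∈ γ '' Set.Icc 0 t \ ball (γ t) (C * infDist (γ t) Ωᶜ),
        connectedComponentIn (Ω \ sphere (γ t) (C * infDist (γ t) Ωᶜ)) y ≠
          connectedComponentIn (Ω \ sphere (γ t) (C * infDist (γ t) Ωᶜ)) x₀

/-- The slice property with constant `C`. Lengths of curve portions are measured via the
Lebesgue measure of parameter preimages of arclength (`1`-Lipschitz) parametrizations. -/
def SliceProperty {n : ℕ} (Ω : Set (Eu n)) (C : ℝ) : Prop :=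
  ∀ x ∈ Ω, ∀ y ∈ Ω, ∃ (j : ℕ) (S : ℕ → Set (Eu n)) (L : ℝ) (γ : ℝ → Eu n),
    0 ≤ L ∧ LipschitzOnWith 1 γ (Set.Icc 0 L) ∧ γ 0 = x ∧ γ L = y ∧
    (∀ t ∈ Set.Icc (0:ℝ) L, γ t ∈ Ω) ∧
    (∀ i ≤ j, IsOpen (S i) ∧ S i ⊆ Ω) ∧
    (∀ i ≤ j, ∀ k ≤ j, i ≠ k → Disjoint (S i) (S k)) ∧
    x ∈ S 0 ∧ y ∈ S j ∧
    (∀ i, 0 < i → i < j →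
      connectedComponentIn (Ω \ closure (S i)) x ≠
        connectedComponentIn (Ω \ closure (S i)) y) ∧
    (∀ (LF : ℝ) (F : ℝ → Eu n), 0 ≤ LF → LipschitzOnWith 1 F (Set.Icc 0 LF) →
      F '' Set.Icc 0 LF ⊆ Ω → (∃ t ∈ Set.Icc (0:ℝ) LF, F t = x) →
      (∃ t ∈ Set.Icc (0:ℝ) LF, F t = y) →
      ∀ i, 0 < i → i < j →
        Metric.diam (S i) ≤ C * (volume {t : ℝ | t ∈ Set.Icc (0:ℝ) LF ∧ F t ∈ S i}).toReal) ∧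
    (∀ t ∈ Set.Icc (0:ℝ) L,
      ball (γ t) (C⁻¹ * infDist (γ t) Ωᶜ) ⊆ ⋃ i ∈ Finset.range (j + 1), S i) ∧
    (∀ i ≤ j, ∀ z ∈ γ '' Set.Icc (0:ℝ) L ∩ S i, Metric.diam (S i) ≤ C * infDist z Ωᶜ) ∧
    (∃ xi : ℕ → Eu n, xi 0 = x ∧ xi j = y ∧
      ∀ i ≤ j, xi i ∈ S i ∧ ball (xi i) (C⁻¹ * infDist (xi i) Ωᶜ) ⊆ S i)

/-- `v : Ω → ℝⁿ` is a distributional gradient of `u` on `U`. -/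
def HasDistribGradOn {n : ℕ} (U : Set (Eu n)) (u : Eu n → ℝ) (v : Eu n → Eu n) : Prop :=
  ∀ φ : Eu n → ℝ, ContDiff ℝ (⊤ : ℕ∞) φ → HasCompactSupport φ → tsupport φ ⊆ U →
    ∀ i : Fin n,
      ∫ x in U, u x * fderiv ℝ φ x (EuclideanSpace.single i 1) = - ∫ x in U, v x i * φ x

/-- `u ∈ Ẇ^{1,p}(U)` with distributional gradient `v ∈ L^p(U;ℝⁿ)`. -/
def MemW1p {n : ℕ} (U : Set (Eu n)) (p : ℝ) (u : Eu n → ℝ) (v : Eu n → Eu n) : Prop :=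
  LocallyIntegrableOn u U volume ∧ AEMeasurable v (volume.restrict U) ∧
    eLpNorm v (ENNReal.ofReal p) (volume.restrict U) < ⊤ ∧ HasDistribGradOn U u v

/-- `Ω` is a `Ẇ^{1,p}`-extension domain. -/
def IsW1pExtensionDomain {n : ℕ} (Ω : Set (Eu n)) (p : ℝ) : Prop :=
  ∃ C : ℝ, 0 < C ∧ ∀ u v, MemW1p Ω p u v →
    ∃ u' v', MemW1p (Set.univ) p u' v' ∧ (∀ᵐ x ∂(volume.restrict Ω), u' x = u x) ∧
      eLpNorm v' (ENNReal.ofReal p) volume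
        ≤ ENNReal.ofReal C * eLpNorm v (ENNReal.ofReal p) (volume.restrict Ω)

/-- The (uncentered over radii, centered) Hardy–Littlewood maximal function, `ℝ≥0∞`-valued. -/
def HLMax {n : ℕ} (g : Eu n → ℝ) (y : Eu n) : ℝ≥0∞ :=
  ⨆ (t : ℝ) (_ : 0 < t), (volume (ball y t))⁻¹ * ∫⁻ z in ball y t, ENNReal.ofReal |g z|

/-- `k` is the quasihyperbolic length of some admissible curve from `x` to `y`. -/
def QC {n : ℕ} (Ω : Set (Eu n)) (x y : Eu n) (k : ℝ) : Prop :=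
  ∃ ℓ : ℝ, 0 ≤ ℓ ∧ ∃ γ : ℝ → Eu n,
    LipschitzOnWith 1 γ (Set.Icc 0 ℓ) ∧ γ 0 = x ∧ γ ℓ = y ∧
    (∀ t ∈ Set.Icc (0:ℝ) ℓ, γ t ∈ Ω) ∧
    k = ∫ t in (0:ℝ)..ℓ, (infDist (γ t) Ωᶜ)⁻¹

theorem qhDist_eq {n : ℕ} (Ω : Set (Eu n)) (x y : Eu n) :
    qhDist Ω x y = sInf {k | QC Ω x y k} := rfl

theorem infDist_pos_of_mem {n : ℕ} {Ω : Set (Eu n)} (hO : IsOpen Ω) (hp : Ωᶜ.Nonempty)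
    {x : Eu n} (hx : x ∈ Ω) : 0 < infDist x Ωᶜ := by
  rw [← hO.isClosed_compl.notMem_iff_infDist_pos hp]
  simpa using hx

theorem QC_contOn {n : ℕ} {Ω : Set (Eu n)} (hO : IsOpen Ω) (hp : Ωᶜ.Nonempty) {ℓ : ℝ}
    {γ : ℝ → Eu n} (hL : LipschitzOnWith 1 γ (Set.Icc 0 ℓ))
    (hm : ∀ t ∈ Set.Icc (0:ℝ) ℓ, γ t ∈ Ω) :
    ContinuousOn (fun t => (infDist (γ t) Ωᶜ)⁻¹) (Set.Icc 0 ℓ) := by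
  apply ContinuousOn.inv₀
  · exact (continuous_infDist_pt _).comp_continuousOn hL.continuousOn
  · intro t ht
    exact (infDist_pos_of_mem hO hp (hm t ht)).ne'

theorem QC_intervalIntegrable {n : ℕ} {Ω : Set (Eu n)} (hO : IsOpen Ω) (hp : Ωᶜ.Nonempty) {ℓ : ℝ}
    {γ : ℝ → Eu n} (hL : LipschitzOnWith 1 γ (Set.Icc 0 ℓ))
    (hm : ∀ t ∈ Set.Icc (0:ℝ) ℓ, γ t ∈ Ω) {a b : ℝ} (ha : 0 ≤ a) (hab : a ≤ b) (hb : b ≤ ℓ) :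
    IntervalIntegrable (fun t => (infDist (γ t) Ωᶜ)⁻¹) volume a b := by
  apply ContinuousOn.intervalIntegrable_of_Icc hab
  exact (QC_contOn hO hp hL hm).mono (Icc_subset_Icc ha hb)

theorem QC_nonneg {n : ℕ} {Ω : Set (Eu n)} {x y : Eu n} {k : ℝ} (h : QC Ω x y k) : 0 ≤ k := by
  obtain ⟨ℓ, h0, γ, -, -, -, -, rfl⟩ := h
  apply intervalIntegral.integral_nonneg h0
  intro t _
  exact inv_nonneg.2 infDist_nonneg

theorem QC_refl {n : ℕ} {Ω : Set (Eu n)} {x : Eu n} (hx : x ∈ Ω) : QC Ω x x 0 := by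
  refine ⟨0, le_rfl, fun _ => x, ?_, rfl, rfl, fun _ _ => hx, by simp⟩
  exact LipschitzOnWith.of_dist_le_mul (by intros; simp)

theorem QC_symm {n : ℕ} {Ω : Set (Eu n)} {x y : Eu n} {k : ℝ} (h : QC Ω x y k) : QC Ω y x k := by
  obtain ⟨ℓ, h0, γ, hL, hx, hy, hm, rfl⟩ := h
  refine ⟨ℓ, h0, fun t => γ (ℓ - t), ?_, by simpa using hy, by simpa using hx, ?_, ?_⟩
  · apply LipschitzOnWith.of_dist_le_mul
    intro s hs t ht
    have := hL.dist_le_mul (ℓ - s) ⟨by linarith [hs.2], by linarith [hs.1]⟩ (ℓ - t)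
      ⟨by linarith [ht.2], by linarith [ht.1]⟩
    rwa [dist_sub_left] at this
  · intro t ht
    exact hm _ ⟨by linarith [ht.2], by linarith [ht.1]⟩
  · rw [intervalIntegral.integral_comp_sub_left (fun t => (infDist (γ t) Ωᶜ)⁻¹)]
    simp

theorem QC_trans {n : ℕ} {Ω : Set (Eu n)} (hO : IsOpen Ω) (hp : Ωᶜ.Nonempty)
    {x y z : Eu n} {k l : ℝ} (h : QC Ω x y k) (h' : QC Ω y z l) : QC Ω x z (k + l) := by
  obtain ⟨ℓ, h0, γ, hL, hx, hy, hm, hk⟩ := h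
  obtain ⟨ℓ', h0', γ', hL', hx', hy', hm', hk'⟩ := h'
  set g : ℝ → Eu n := fun t => if t ≤ ℓ then γ t else γ' (t - ℓ) with hg
  have g1 : ∀ t ≤ ℓ, g t = γ t := fun t ht => by simp [hg, ht]
  have g2 : ∀ t, ℓ ≤ t → g t = γ' (t - ℓ) := by
    intro t ht
    rcases ht.eq_or_lt with rfl | h
    · simp [hg, hy, hx']
    · simp [hg, not_le.2 h]
  have key : ∀ s ∈ Set.Icc (0:ℝ) (ℓ + ℓ'), ∀ t ∈ Set.Icc (0:ℝ) (ℓ + ℓ'), s ≤ t →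
      dist (g s) (g t) ≤ t - s := by
    intro s hs t ht hst
    have d1 : ∀ s ∈ Set.Icc (0:ℝ) ℓ, ∀ t ∈ Set.Icc (0:ℝ) ℓ, s ≤ t →
        dist (γ s) (γ t) ≤ t - s := by
      intro s hs t ht hst
      have := hL.dist_le_mul s hs t ht
      rw [dist_comm s t, Real.dist_eq, abs_of_nonneg (by linarith)] at this
      simpa using this
    have d2 : ∀ s ∈ Set.Icc (0:ℝ) ℓ', ∀ t ∈ Set.Icc (0:ℝ) ℓ', s ≤ t →
        dist (γ' s) (γ' t) ≤ t - s := by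
      intro s hs t ht hst
      have := hL'.dist_le_mul s hs t ht
      rw [dist_comm s t, Real.dist_eq, abs_of_nonneg (by linarith)] at this
      simpa using this
    rcases le_total t ℓ with h1 | h1
    · rw [g1 _ h1, g1 _ (hst.trans h1)]
      exact d1 s ⟨hs.1, hst.trans h1⟩ t ⟨ht.1, h1⟩ hst
    · rcases le_total s ℓ with h2 | h2
      · have a1 := d1 s ⟨hs.1, h2⟩ ℓ ⟨h0, le_rfl⟩ h2
        have a2 := d2 0 ⟨le_rfl, h0'⟩ (t - ℓ) ⟨by linarith, by linarith [ht.2]⟩ (by linarith)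
        rw [g1 _ h2, g2 _ h1]
        rw [hy] at a1
        rw [hx'] at a2
        have := dist_triangle (γ s) y (γ' (t - ℓ))
        linarith
      · rw [g2 _ h1, g2 _ h2]
        have := d2 (s - ℓ) ⟨by linarith, by linarith [hs.2]⟩ (t - ℓ)
          ⟨by linarith, by linarith [ht.2]⟩ (by linarith)
        linarith
  have gL : LipschitzOnWith 1 g (Set.Icc 0 (ℓ + ℓ')) := by
    apply LipschitzOnWith.of_dist_le_mul
    intro s hs t ht
    rw [NNReal.coe_one, one_mul, Real.dist_eq]
    rcases le_total s t with h | h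
    · have := key s hs t ht h
      rw [abs_sub_comm]
      exact this.trans (le_abs_self _)
    · have := key t ht s hs h
      rw [dist_comm]
      exact this.trans (le_abs_self _)
  have gm : ∀ t ∈ Set.Icc (0:ℝ) (ℓ + ℓ'), g t ∈ Ω := by
    intro t ht
    rcases le_total t ℓ with h1 | h1
    · rw [g1 _ h1]; exact hm t ⟨ht.1, h1⟩
    · rw [g2 _ h1]; exact hm' _ ⟨by linarith, by linarith [ht.2]⟩
  refine ⟨ℓ + ℓ', by linarith, g, gL, ?_, ?_, gm, ?_⟩
  · rw [g1 _ h0, hx]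
  · rw [g2 _ (by linarith)]; simpa using hy'
  · rw [← intervalIntegral.integral_add_adjacent_intervals
      (QC_intervalIntegrable hO hp gL gm le_rfl h0 (by linarith))
      (QC_intervalIntegrable hO hp gL gm h0 (by linarith) le_rfl), hk, hk']
    congr 1
    · apply intervalIntegral.integral_congr
      intro t ht
      rw [uIcc_of_le h0] at ht
      simp only [g1 t ht.2]
    · have e : ∫ t in ℓ..(ℓ + ℓ'), (infDist (g t) Ωᶜ)⁻¹
          = ∫ t in ℓ..(ℓ + ℓ'), (fun u => (infDist (γ' u) Ωᶜ)⁻¹) (t - ℓ) := by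
        apply intervalIntegral.integral_congr
        intro t ht
        rw [uIcc_of_le (by linarith)] at ht
        simp only [g2 t ht.1]
      rw [e, intervalIntegral.integral_comp_sub_right (fun u => (infDist (γ' u) Ωᶜ)⁻¹)]
      simp

/-- Splitting a curve at an intermediate parameter. -/
theorem QC_split {n : ℕ} {Ω : Set (Eu n)} (hO : IsOpen Ω) (hp : Ωᶜ.Nonempty) {ℓ : ℝ}
    {γ : ℝ → Eu n} (hL : LipschitzOnWith 1 γ (Set.Icc 0 ℓ))
    (hm : ∀ t ∈ Set.Icc (0:ℝ) ℓ, γ t ∈ Ω) {t : ℝ} (ht : t ∈ Set.Icc 0 ℓ) :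
    ∃ k l, QC Ω (γ 0) (γ t) k ∧ QC Ω (γ t) (γ ℓ) l ∧
      k + l = ∫ t in (0:ℝ)..ℓ, (infDist (γ t) Ωᶜ)⁻¹ := by
  refine ⟨∫ t in (0:ℝ)..t, (infDist (γ t) Ωᶜ)⁻¹, ∫ t in t..ℓ, (infDist (γ t) Ωᶜ)⁻¹, ?_, ?_, ?_⟩
  · exact ⟨t, ht.1, γ, hL.mono (Icc_subset_Icc le_rfl ht.2), rfl, rfl,
      fun s hs => hm s ⟨hs.1, hs.2.trans ht.2⟩, rfl⟩
  · refine ⟨ℓ - t, by linarith [ht.2], fun s => γ (s + t), ?_, by simp, by simp, ?_, ?_⟩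
    · apply LipschitzOnWith.of_dist_le_mul
      intro a ha b hb
      have := hL.dist_le_mul (a + t) ⟨by linarith [ht.1, ha.1], by linarith [ha.2]⟩ (b + t)
        ⟨by linarith [ht.1, hb.1], by linarith [hb.2]⟩
      simpa using this
    · intro s hs
      exact hm _ ⟨by linarith [ht.1, hs.1], by linarith [hs.2]⟩
    · rw [intervalIntegral.integral_comp_add_right (fun u => (infDist (γ u) Ωᶜ)⁻¹)]
      simp
  · exact intervalIntegral.integral_add_adjacent_intervals
      (QC_intervalIntegrable hO hp hL hm le_rfl ht.1 ht.2)
      (QC_intervalIntegrable hO hp hL hm ht.1 ht.2 le_rfl)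

theorem infDist_le_add {n : ℕ} (S : Set (Eu n)) (x y : Eu n) :
    infDist x S ≤ infDist y S + dist x y := infDist_le_infDist_add_dist

/-- Points close to `x` relative to the boundary distance lie in `Ω`. -/
theorem mem_of_dist_lt {n : ℕ} {Ω : Set (Eu n)} {x y : Eu n}
    (h : dist x y < infDist x Ωᶜ) : y ∈ Ω := by
  by_contra hy
  have := infDist_le_dist_of_mem (x := x) (s := Ωᶜ) hy
  linarith

/-- Straight segments. -/
theorem QC_segment {n : ℕ} {Ω : Set (Eu n)} (hO : IsOpen Ω) (hp : Ωᶜ.Nonempty) {x y : Eu n}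
    (h : dist x y < infDist x Ωᶜ) :
    ∃ k, QC Ω x y k ∧ k ≤ dist x y / (infDist x Ωᶜ - dist x y) := by
  set r := dist x y with hr
  have hpos : 0 < infDist x Ωᶜ := lt_of_le_of_lt dist_nonneg h
  rcases (dist_nonneg : 0 ≤ dist x y).eq_or_lt with h0 | h0
  · have : x = y := by rw [← dist_eq_zero]; exact h0.symm
    subst this
    refine ⟨0, QC_refl (mem_of_dist_lt h), ?_⟩
    simp [hr]
  rw [← hr] at h0
  set γ : ℝ → Eu n := fun t => x + (t / r) • (y - x) with hγ
  have hn : ‖y - x‖ = r := by rw [hr, dist_comm, dist_eq_norm]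
  have hd : ∀ s t, dist (γ s) (γ t) = |s - t| := by
    intro s t
    rw [hγ, dist_eq_norm]
    have : x + (s / r) • (y - x) - (x + (t / r) • (y - x)) = ((s - t) / r) • (y - x) := by
      rw [sub_div, sub_smul]; abel
    rw [this, norm_smul, hn, Real.norm_eq_abs, abs_div, abs_of_pos h0]
    field_simp
  have h00 : γ 0 = x := by simp [hγ]
  have hdx : ∀ t ∈ Set.Icc (0:ℝ) r, dist x (γ t) ≤ r := by
    intro t ht
    rw [← h00, hd, zero_sub, abs_neg, abs_of_nonneg ht.1]; exact ht.2
  have hL : LipschitzOnWith 1 γ (Set.Icc 0 r) := by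
    apply LipschitzOnWith.of_dist_le_mul
    intro s _ t _
    rw [hd, Real.dist_eq]; simp
  have hm : ∀ t ∈ Set.Icc (0:ℝ) r, γ t ∈ Ω := fun t ht =>
    mem_of_dist_lt (lt_of_le_of_lt (hdx t ht) h)
  refine ⟨_, ⟨r, h0.le, γ, hL, h00, ?_, hm, rfl⟩, ?_⟩
  · simp [hγ, h0.ne']
  · calc ∫ t in (0:ℝ)..r, (infDist (γ t) Ωᶜ)⁻¹ ≤ ∫ t in (0:ℝ)..r, (infDist x Ωᶜ - r)⁻¹ := by
          apply intervalIntegral.integral_mono_on h0.le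
            (QC_intervalIntegrable hO hp hL hm le_rfl h0.le le_rfl) (by simp)
          intro t ht
          apply inv_anti₀ (by linarith)
          have := infDist_le_add Ωᶜ x (γ t)
          linarith [hdx t ht]
      _ = _ := by simp [div_eq_mul_inv]

theorem QC_exists {n : ℕ} {Ω : Set (Eu n)} (hΩ : IsDomainEu Ω) (hp : Ωᶜ.Nonempty) {x y : Eu n}
    (hx : x ∈ Ω) (hy : y ∈ Ω) : ∃ k, QC Ω x y k := by
  obtain ⟨hO, hC⟩ := hΩ
  apply hC.isPreconnected.induction₂ (fun x y => ∃ k, QC Ω x y k) _ _ _ hx hy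
  · intro x hx
    apply mem_nhdsWithin_of_mem_nhds
    filter_upwards [ball_mem_nhds x (infDist_pos_of_mem hO hp hx)] with y hy
    rw [mem_ball, dist_comm] at hy
    obtain ⟨k, hk, -⟩ := QC_segment hO hp hy
    exact ⟨k, hk⟩
  · rintro x y z _ _ _ ⟨k, hk⟩ ⟨l, hl⟩
    exact ⟨k + l, QC_trans hO hp hk hl⟩
  · rintro x y _ _ ⟨k, hk⟩
    exact ⟨k, QC_symm hk⟩

theorem QC_bddBelow {n : ℕ} (Ω : Set (Eu n)) (x y : Eu n) : BddBelow {k | QC Ω x y k} :=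
  ⟨0, fun _ h => QC_nonneg h⟩

theorem qhDist_le {n : ℕ} {Ω : Set (Eu n)} {x y : Eu n} {k : ℝ} (h : QC Ω x y k) :
    qhDist Ω x y ≤ k := csInf_le (QC_bddBelow Ω x y) h

theorem qhDist_nonneg {n : ℕ} (Ω : Set (Eu n)) (x y : Eu n) : 0 ≤ qhDist Ω x y :=
  Real.sInf_nonneg fun _ h => QC_nonneg h

theorem qhDist_self {n : ℕ} {Ω : Set (Eu n)} {x : Eu n} (hx : x ∈ Ω) : qhDist Ω x x = 0 :=
  le_antisymm (qhDist_le (QC_refl hx)) (qhDist_nonneg _ _ _)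

theorem qhDist_comm {n : ℕ} (Ω : Set (Eu n)) (x y : Eu n) : qhDist Ω x y = qhDist Ω y x := by
  rw [qhDist_eq, qhDist_eq]
  congr 1
  ext k
  exact ⟨QC_symm, QC_symm⟩

theorem exists_QC_lt {n : ℕ} {Ω : Set (Eu n)} (hΩ : IsDomainEu Ω) (hp : Ωᶜ.Nonempty) {x y : Eu n}
    (hx : x ∈ Ω) (hy : y ∈ Ω) {a : ℝ} (h : qhDist Ω x y < a) : ∃ k, QC Ω x y k ∧ k < a :=
  exists_lt_of_csInf_lt (QC_exists hΩ hp hx hy) h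

theorem qhDist_triangle {n : ℕ} {Ω : Set (Eu n)} (hΩ : IsDomainEu Ω) (hp : Ωᶜ.Nonempty)
    {x y z : Eu n} (hx : x ∈ Ω) (hy : y ∈ Ω) (hz : z ∈ Ω) :
    qhDist Ω x z ≤ qhDist Ω x y + qhDist Ω y z := by
  apply le_of_forall_pos_le_add
  intro e he
  obtain ⟨k, hk, hk'⟩ := exists_QC_lt hΩ hp hx hy (lt_add_of_pos_right _ (half_pos he))
  obtain ⟨l, hl, hl'⟩ := exists_QC_lt hΩ hp hy hz (lt_add_of_pos_right _ (half_pos he))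
  have := qhDist_le (QC_trans hΩ.1 hp hk hl)
  linarith

theorem qhDist_le_of_dist {n : ℕ} {Ω : Set (Eu n)} (hO : IsOpen Ω) (hp : Ωᶜ.Nonempty) {x y : Eu n}
    (h : dist x y < infDist x Ωᶜ) :
    qhDist Ω x y ≤ dist x y / (infDist x Ωᶜ - dist x y) := by
  obtain ⟨k, hk, hk'⟩ := QC_segment hO hp h
  exact (qhDist_le hk).trans hk'

theorem QC_lower {n : ℕ} {Ω : Set (Eu n)} (hO : IsOpen Ω) (hp : Ωᶜ.Nonempty) {x y : Eu n}
    (hx : x ∈ Ω) {k : ℝ} (h : QC Ω x y k) :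
    dist x y ≤ (Real.exp k - 1) * infDist x Ωᶜ := by
  obtain ⟨ℓ, h0, γ, hL, h1, h2, hm, hk⟩ := h
  have hd := infDist_pos_of_mem hO hp hx
  set d := infDist x Ωᶜ with hdd
  have hdist : ∀ t ∈ Set.Icc (0:ℝ) ℓ, dist x (γ t) ≤ t := by
    intro t ht
    have := hL.dist_le_mul 0 ⟨le_rfl, h0⟩ t ht
    rw [h1, dist_comm 0 t, Real.dist_eq, sub_zero, abs_of_nonneg ht.1] at this
    simpa using this
  have hI : ∫ t in (0:ℝ)..ℓ, (t + d)⁻¹ = Real.log ((ℓ + d) / d) := by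
    rw [intervalIntegral.integral_comp_add_right (fun u => u⁻¹),
      integral_inv_of_pos (by linarith) (by linarith)]
    simp
  have hle : Real.log ((ℓ + d) / d) ≤ k := by
    rw [← hI, hk]
    apply intervalIntegral.integral_mono_on h0 _
      (QC_intervalIntegrable hO hp hL hm le_rfl h0 le_rfl)
    · intro t ht
      apply inv_anti₀ (infDist_pos_of_mem hO hp (hm t ht))
      have := infDist_le_add Ωᶜ (γ t) x
      rw [dist_comm] at this
      linarith [hdist t ht]
    · apply ContinuousOn.intervalIntegrable_of_Icc h0
      apply ContinuousOn.inv₀ (by fun_prop)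
      intro t ht
      linarith [ht.1]
  rw [Real.log_le_iff_le_exp (by positivity), div_le_iff₀ hd] at hle
  have := hdist ℓ ⟨h0, le_rfl⟩
  rw [h2] at this
  linarith

theorem dist_le_of_qhDist {n : ℕ} {Ω : Set (Eu n)} (hΩ : IsDomainEu Ω) (hp : Ωᶜ.Nonempty)
    {x y : Eu n} (hx : x ∈ Ω) (hy : y ∈ Ω) :
    dist x y ≤ (Real.exp (qhDist Ω x y) - 1) * infDist x Ωᶜ := by
  have hc : Filter.Tendsto (fun k => (Real.exp k - 1) * infDist x Ωᶜ)
      (nhdsWithin (qhDist Ω x y) (Ioi (qhDist Ω x y)))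
      (nhds ((Real.exp (qhDist Ω x y) - 1) * infDist x Ωᶜ)) := by
    apply Filter.Tendsto.mono_left _ nhdsWithin_le_nhds
    exact Continuous.tendsto (by fun_prop) _
  apply ge_of_tendsto hc
  filter_upwards [self_mem_nhdsWithin] with a ha
  obtain ⟨k, hk, hk'⟩ := exists_QC_lt hΩ hp hx hy ha
  have := QC_lower hΩ.1 hp hx hk
  have h3 : Real.exp k ≤ Real.exp a := Real.exp_le_exp.2 hk'.le
  have := infDist_pos_of_mem hΩ.1 hp hx
  nlinarith

theorem infDist_le_of_qhDist {n : ℕ} {Ω : Set (Eu n)} (hΩ : IsDomainEu Ω) (hp : Ωᶜ.Nonempty)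
    {x y : Eu n} (hx : x ∈ Ω) (hy : y ∈ Ω) :
    infDist y Ωᶜ ≤ Real.exp (qhDist Ω x y) * infDist x Ωᶜ := by
  have := dist_le_of_qhDist hΩ hp hx hy
  have h2 := infDist_le_add Ωᶜ y x
  rw [dist_comm] at h2
  linarith

theorem qhDist_continuousOn {n : ℕ} {Ω : Set (Eu n)} (hΩ : IsDomainEu Ω) (hp : Ωᶜ.Nonempty)
    {x₀ : Eu n} (h0 : x₀ ∈ Ω) : ContinuousOn (fun x => qhDist Ω x₀ x) Ω := by
  intro x hx
  apply ContinuousAt.continuousWithinAt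
  have hd := infDist_pos_of_mem hΩ.1 hp hx
  have hc : Filter.Tendsto (fun y => dist x y / (infDist x Ωᶜ - dist x y)) (nhds x) (nhds 0) := by
    have : ContinuousAt (fun y => dist x y / (infDist x Ωᶜ - dist x y)) x := by
      apply ContinuousAt.div (by fun_prop) (by fun_prop)
      simpa using hd.ne'
    have h2 := this.tendsto
    simpa using h2
  rw [ContinuousAt, tendsto_iff_dist_tendsto_zero]
  apply squeeze_zero' (Filter.Eventually.of_forall fun _ => dist_nonneg) _ hc
  filter_upwards [ball_mem_nhds x hd] with y hy
  rw [mem_ball, dist_comm] at hy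
  have hy' := mem_of_dist_lt hy
  have h1 := qhDist_le_of_dist hΩ.1 hp hy
  have h2 := qhDist_triangle hΩ hp h0 hx hy'
  have h3 := qhDist_triangle hΩ hp h0 hy' hx
  rw [qhDist_comm Ω y x] at h3
  rw [Real.dist_eq, abs_le]
  constructor <;> linarith

/-- The predecessor of a point on a nearly optimal curve. -/
theorem exists_pred {n : ℕ} {Ω : Set (Eu n)} (hΩ : IsDomainEu Ω) (hp : Ωᶜ.Nonempty)
    {x₀ x : Eu n} (h0 : x₀ ∈ Ω) (hx : x ∈ Ω) (hk : 1 ≤ qhDist Ω x₀ x) :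
    ∃ z ∈ Ω, qhDist Ω x₀ z = qhDist Ω x₀ x - 1 ∧ qhDist Ω x z ≤ 2 := by
  obtain ⟨k, ⟨ℓ, hl, γ, hL, h1, h2, hm, hk1⟩, hk2⟩ :=
    exists_QC_lt hΩ hp h0 hx (lt_add_one (qhDist Ω x₀ x))
  have hc : ContinuousOn (fun t => qhDist Ω x₀ (γ t)) (Icc 0 ℓ) :=
    (qhDist_continuousOn hΩ hp h0).comp hL.continuousOn hm
  have := intermediate_value_Icc hl hc
  simp only [h1, h2, qhDist_self h0] at this
  obtain ⟨t, ht, ht'⟩ := this (show qhDist Ω x₀ x - 1 ∈ _ from ⟨by linarith, by linarith⟩)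
  simp only at ht'
  obtain ⟨a, b, ha, hb, hab⟩ := QC_split hΩ.1 hp hL hm ht
  rw [h1] at ha
  rw [h2] at hb
  refine ⟨γ t, hm t ht, ht', ?_⟩
  have h3 := qhDist_le ha
  have h4 := qhDist_le (QC_symm hb)
  linarith

theorem weakCarrot_of_integral {n : ℕ} (Ω : Set (Eu n)) (hΩ : IsDomainEu Ω)
    (hproper : Ωᶜ.Nonempty) (x₀ : Eu n) (hx₀ : x₀ ∈ Ω) (hn : 2 ≤ n) (σ : ℝ) (hσ : 0 < σ)
    (hI : (∫⁻ x in Ω, ENNReal.ofReal (Real.exp (σ * qhDist Ω x₀ x))) < ⊤) : IsWeakCarrot Ω := by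
  have hn0 : (0:ℝ) < n := by
    have : 0 < n := by omega
    exact_mod_cast this
  set I := (∫⁻ x in Ω, ENNReal.ofReal (Real.exp (σ * qhDist Ω x₀ x))) with hIdef
  set V := (volume (ball (0 : Eu n) 1)).toReal with hV
  have hVpos : 0 < V := ENNReal.toReal_pos (measure_ball_pos _ _ one_pos).ne' measure_ball_lt_top.ne
  -- the basic estimate
  have key : ∀ x ∈ Ω, Real.exp (σ * (qhDist Ω x₀ x - 1)) * ((infDist x Ωᶜ / 2) ^ n * V)
      ≤ I.toReal + 1 := by
    intro x hx
    have hd := infDist_pos_of_mem hΩ.1 hproper hx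
    set d := infDist x Ωᶜ with hdd
    have hsub : ball x (d / 2) ⊆ Ω := by
      intro y hy
      rw [mem_ball, dist_comm] at hy
      exact mem_of_dist_lt (by linarith)
    have hvol : volume (ball x (d / 2)) = ENNReal.ofReal ((d / 2) ^ n * V) := by
      rw [Measure.addHaar_ball_of_pos _ _ (by positivity), ENNReal.ofReal_mul (by positivity), hV,
        ENNReal.ofReal_toReal measure_ball_lt_top.ne]
      simp
    have h1 : ENNReal.ofReal (Real.exp (σ * (qhDist Ω x₀ x - 1))) * volume (ball x (d / 2))
        ≤ I := by
      rw [← setLIntegral_const]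
      calc _ ≤ ∫⁻ y in ball x (d / 2), ENNReal.ofReal (Real.exp (σ * qhDist Ω x₀ y)) := by
            apply setLIntegral_mono' measurableSet_ball
            intro y hy
            apply ENNReal.ofReal_le_ofReal
            apply Real.exp_le_exp.2
            apply mul_le_mul_of_nonneg_left _ hσ.le
            have hyΩ := hsub hy
            rw [mem_ball, dist_comm] at hy
            have h2 := qhDist_le_of_dist hΩ.1 hproper (show dist x y < infDist x Ωᶜ by linarith)
            have h3 : dist x y / (d - dist x y) ≤ 1 := by
              rw [div_le_one (by linarith)]
              linarith
            have h4 := qhDist_triangle hΩ hproper hx₀ hyΩ hx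
            rw [qhDist_comm Ω y x] at h4
            linarith
        _ ≤ I := lintegral_mono_set hsub
    rw [hvol, ← ENNReal.ofReal_mul (by positivity)] at h1
    have h2 := ENNReal.toReal_mono hI.ne h1
    rw [ENNReal.toReal_ofReal (by positivity)] at h2
    linarith
  set J := I.toReal + 1 with hJ
  have hJpos : 0 < J := by have : 0 ≤ I.toReal := ENNReal.toReal_nonneg; linarith
  -- logarithmic form
  set b := (Real.log J - Real.log V + n * Real.log 2 + σ) with hb
  have key2 : ∀ x ∈ Ω, σ * qhDist Ω x₀ x ≤ b - n * Real.log (infDist x Ωᶜ) := by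
    intro x hx
    have hd := infDist_pos_of_mem hΩ.1 hproper hx
    have h := Real.log_le_log (by positivity) (key x hx)
    rw [Real.log_mul (by positivity) (by positivity), Real.log_mul (by positivity) (by positivity),
      Real.log_exp, Real.log_pow, Real.log_div hd.ne' (by norm_num)] at h
    rw [hb]
    linarith
  have hub : ∀ x ∈ Ω, Real.log (infDist x Ωᶜ) ≤ |b| / n := by
    intro x hx
    have h1 := key2 x hx
    have h2 : 0 ≤ σ * qhDist Ω x₀ x := mul_nonneg hσ.le (qhDist_nonneg _ _ _)
    rw [le_div_iff₀ hn0]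
    have := le_abs_self b
    linarith
  set L := |b| / n with hL
  have hL0 : 0 ≤ L := by positivity
  set C := Real.exp (L + 1) + n / σ + |b| / σ with hC
  have hCexp : Real.exp (L + 1) ≤ C := by
    have : 0 ≤ n / σ + |b| / σ := by positivity
    linarith
  have hCpos : 0 < C := lt_of_lt_of_le (Real.exp_pos _) hCexp
  have hC1 : 1 ≤ C := by
    have := Real.add_one_le_exp (L + 1)
    linarith
  have hlogC : L + 1 ≤ Real.log C := by
    rw [Real.le_log_iff_exp_le hCpos]; exact hCexp
  refine ⟨x₀, hx₀, C, hC1, ?_⟩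
  intro x hx
  have hd := infDist_pos_of_mem hΩ.1 hproper hx
  rw [Real.log_div hCpos.ne' hd.ne', qhDist_comm]
  set l := Real.log (infDist x Ωᶜ) with hl
  have h1 : qhDist Ω x₀ x ≤ |b| / σ - n / σ * l := by
    have h := key2 x hx
    have h3 : |b| / σ - n / σ * l = (|b| - n * l) / σ := by field_simp
    rw [h3, le_div_iff₀ hσ]
    have := le_abs_self b
    linarith
  have h2 := hub x hx
  have e1 := Real.exp_pos (L + 1)
  have e2 : 0 ≤ (n:ℝ) / σ := by positivity
  have e3 : 0 ≤ |b| / σ := by positivity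
  have p1 : 0 ≤ (Real.exp (L + 1) + |b| / σ) * (Real.log C - l - 1) :=
    mul_nonneg (by linarith) (by linarith)
  have p2 : 0 ≤ (n:ℝ) / σ * (Real.log C) := mul_nonneg e2 (by linarith)
  have : C * (Real.log C - l) = (Real.exp (L + 1) + |b| / σ) * (Real.log C - l - 1)
      + (Real.exp (L + 1) + |b| / σ) + n / σ * Real.log C - n / σ * l := by
    rw [hC]; ring
  rw [this]
  linarith

/-- Lipschitz cutoff adapted to the ball `B(c, lam * r)`. -/
def cutW {n : ℕ} (lam : ℝ) (c : Eu n) (r : ℝ) (x : Eu n) : ℝ :=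
  max 0 (min 1 (2 - dist x c / (lam * r)))

theorem cutW_nonneg {n : ℕ} (lam : ℝ) (c : Eu n) (r : ℝ) (x : Eu n) : 0 ≤ cutW lam c r x :=
  le_max_left _ _

theorem cutW_le_one {n : ℕ} (lam : ℝ) (c : Eu n) (r : ℝ) (x : Eu n) : cutW lam c r x ≤ 1 :=
  max_le zero_le_one (min_le_left _ _)

theorem cutW_eq_one {n : ℕ} {lam : ℝ} {c : Eu n} {r : ℝ} {x : Eu n} (hl : 0 < lam) (hr : 0 < r)
    (h : dist x c ≤ lam * r) : cutW lam c r x = 1 := by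
  have : dist x c / (lam * r) ≤ 1 := (div_le_one (by positivity)).2 h
  rw [cutW, min_eq_left (by linarith), max_eq_right zero_le_one]

theorem cutW_eq_zero {n : ℕ} {lam : ℝ} {c : Eu n} {r : ℝ} {x : Eu n} (hl : 0 < lam) (hr : 0 < r)
    (h : 2 * lam * r ≤ dist x c) : cutW lam c r x = 0 := by
  have : 2 ≤ dist x c / (lam * r) := (le_div_iff₀ (by positivity)).2 (by linarith)
  rw [cutW, max_eq_left]
  exact (min_le_right _ _).trans (by linarith)

theorem cutW_sub_le {n : ℕ} {lam : ℝ} {c : Eu n} {r : ℝ} {x y : Eu n} (hl : 0 < lam) (hr : 0 < r) :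
    cutW lam c r x - cutW lam c r y ≤ dist x y / (lam * r) := by
  have h1 : dist y c / (lam * r) ≤ dist x y / (lam * r) + dist x c / (lam * r) := by
    rw [← add_div]
    gcongr
    rw [dist_comm x y]
    exact dist_triangle _ _ _
  have h0 : 0 ≤ dist x y / (lam * r) := by positivity
  unfold cutW
  rw [sub_le_iff_le_add]
  apply max_le
  · exact add_nonneg h0 (le_max_left _ _)
  · have : min 1 (2 - dist x c / (lam * r)) ≤
        dist x y / (lam * r) + min 1 (2 - dist y c / (lam * r)) := by
      rcases min_choice 1 (2 - dist y c / (lam * r)) with h | h <;> rw [h]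
      · linarith [min_le_left 1 (2 - dist x c / (lam * r))]
      · linarith [min_le_right 1 (2 - dist x c / (lam * r))]
    linarith [le_max_right 0 (min 1 (2 - dist y c / (lam * r)))]

theorem cutW_continuous {n : ℕ} (lam : ℝ) (c : Eu n) (r : ℝ) : Continuous (cutW lam c r) := by
  unfold cutW
  fun_prop

theorem kernel_integrable (n : ℕ) :
    Integrable (fun u : Eu n => ((1 + ‖u‖) ^ (n + 1))⁻¹) volume := by
  have := integrable_one_add_norm (E := Eu n) (μ := volume) (r := (n:ℝ) + 1) (by simp)
  refine this.congr (Filter.Eventually.of_forall fun u => ?_)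
  simp only
  rw [Real.rpow_neg (by positivity)]
  congr 1
  exact_mod_cast Real.rpow_natCast (1 + ‖u‖) (n + 1)

theorem volume_ball_eq {n : ℕ} (c : Eu n) {r : ℝ} (hr : 0 < r) :
    (volume (ball c r)).toReal = r ^ n * (volume (ball (0 : Eu n) 1)).toReal := by
  rw [Measure.addHaar_ball_of_pos _ _ hr, ENNReal.toReal_mul, ENNReal.toReal_ofReal (by positivity)]
  simp

/-- The packing estimate. -/
theorem variation {n : ℕ} {ι : Type} (c : ι → Eu n) (r : ι → ℝ) (hr : ∀ i, 0 < r i)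
    (hdisj : Pairwise (Function.onFun Disjoint fun i => ball (c i) (r i))) (lam : ℝ)
    (hlam : 1 ≤ lam) :
    ∃ A : ℝ, ∀ (F : Finset ι) (r0 : ℝ), 0 < r0 → (∀ i ∈ F, r0 ≤ r i) → ∀ x y : Eu n,
      dist x y ≤ 3 * lam * r0 →
      ∑ i ∈ F, cutW lam (c i) (r i) x ≤ ∑ i ∈ F, cutW lam (c i) (r i) y + A := by
  set V := (volume (ball (0 : Eu n) 1)).toReal with hV
  have hVpos : 0 < V := ENNReal.toReal_pos (measure_ball_pos _ _ one_pos).ne' measure_ball_lt_top.ne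
  set g : Eu n → ℝ := fun u => ((1 + ‖u‖) ^ (n + 1))⁻¹ with hg
  set K := 3 * (2 * lam + 2) ^ (n + 1) / V with hK
  have hKpos : 0 < K := by positivity
  refine ⟨K * ∫ u, g u, ?_⟩
  intro F r0 h0 hF x y hxy
  set h : Eu n → ℝ := fun z => (r0 ^ n)⁻¹ * g (r0⁻¹ • (z - x)) with hh
  have hgi : Integrable g := kernel_integrable n
  have hhi : Integrable h := by
    apply Integrable.const_mul
    have := (hgi.comp_smul (inv_ne_zero h0.ne')).comp_sub_right x
    exact this
  have hhnn : ∀ z, 0 ≤ h z := fun z => by positivity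
  have hKernelMass : ∫ z, h z = ∫ u, g u := by
    rw [hh, integral_const_mul, integral_sub_right_eq_self (fun z => g (r0⁻¹ • z)) x,
      Measure.integral_comp_inv_smul_of_nonneg _ _ h0.le]
    simp only [finrank_euclideanSpace, Fintype.card_fin, smul_eq_mul]
    field_simp
  have key : ∀ i ∈ F, cutW lam (c i) (r i) x ≤
      cutW lam (c i) (r i) y + K * ∫ z in ball (c i) (r i), h z := by
    intro i hi
    have hri := hr i
    have hIntNonneg : 0 ≤ ∫ z in ball (c i) (r i), h z := integral_nonneg hhnn
    by_cases hx : 2 * lam * r i ≤ dist x (c i)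
    · rw [cutW_eq_zero (by linarith) hri hx]
      exact add_nonneg (cutW_nonneg lam (c i) (r i) y) (mul_nonneg hKpos.le hIntNonneg)
    push Not at hx
    have h1 : cutW lam (c i) (r i) x - cutW lam (c i) (r i) y ≤ 3 * (r0 / r i) := by
      refine (cutW_sub_le (by linarith) hri).trans ?_
      rw [div_le_iff₀ (by positivity)]
      have : 3 * (r0 / r i) * (lam * r i) = 3 * lam * r0 := by field_simp
      linarith
    have h2 : 3 * (r0 / r i) ≤ K * ∫ z in ball (c i) (r i), h z := by
      have hlow : (r0 ^ n)⁻¹ * (((2 * lam + 2) * r i / r0) ^ (n + 1))⁻¹ * (r i ^ n * V)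
          ≤ ∫ z in ball (c i) (r i), h z := by
        calc _ = ∫ z in ball (c i) (r i), (r0 ^ n)⁻¹ * (((2 * lam + 2) * r i / r0) ^ (n + 1))⁻¹ := by
              rw [setIntegral_const, smul_eq_mul, Measure.real, volume_ball_eq _ hri]
              ring
          _ ≤ _ := by
              apply setIntegral_mono_on _ hhi.integrableOn measurableSet_ball
              · intro z hz
                rw [mem_ball] at hz
                simp only [hh, hg]
                gcongr
                rw [norm_smul, ← dist_eq_norm, Real.norm_eq_abs, abs_of_pos (inv_pos.2 h0)]
                have h5 : dist z x ≤ (2 * lam + 1) * r i := by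
                  have := dist_triangle_right z x (c i)
                  linarith
                have h6 := hF i hi
                rw [le_div_iff₀ h0, add_mul, mul_comm (r0⁻¹), mul_assoc, inv_mul_cancel₀ h0.ne']
                linarith
              · exact integrableOn_const measure_ball_lt_top.ne
      refine le_trans (le_of_eq ?_) (mul_le_mul_of_nonneg_left hlow hKpos.le)
      rw [hK]
      have : 0 < 2 * lam + 2 := by linarith
      rw [div_pow, mul_pow]
      field_simp
      ring
    linarith
  calc ∑ i ∈ F, cutW lam (c i) (r i) x
      ≤ ∑ i ∈ F, (cutW lam (c i) (r i) y + K * ∫ z in ball (c i) (r i), h z) :=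
        Finset.sum_le_sum key
    _ = ∑ i ∈ F, cutW lam (c i) (r i) y + K * ∑ i ∈ F, ∫ z in ball (c i) (r i), h z := by
        rw [Finset.sum_add_distrib, Finset.mul_sum]
    _ ≤ _ := by
        gcongr
        rw [← integral_biUnion_finset F (fun i _ => measurableSet_ball)
          (fun i _ j _ hij => hdisj hij) (fun i _ => hhi.integrableOn), ← hKernelMass]
        exact setIntegral_le_integral hhi (Filter.Eventually.of_forall hhnn)

theorem exists_sigma (A B : ℝ) : ∃ σ : ℝ, 0 < σ ∧
    (Real.exp σ - 1) * (Real.exp (σ * A) * (B * Real.exp (σ * A))) ≤ 1 / 2 := by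
  have hc : Continuous fun σ : ℝ =>
    (Real.exp σ - 1) * (Real.exp (σ * A) * (B * Real.exp (σ * A))) := by fun_prop
  have h := (hc.tendsto 0).mono_left (nhdsWithin_le_nhds (s := Ioi (0:ℝ)))
  simp only [Real.exp_zero, sub_self, zero_mul] at h
  have h2 := (h.eventually (ge_mem_nhds (show (0:ℝ) < 1 / 2 by norm_num))).and
    (self_mem_nhdsWithin (s := Ioi (0:ℝ)))
  obtain ⟨σ, h3, h4⟩ := h2.exists
  exact ⟨σ, h4, h3⟩

theorem exp_int {n : ℕ} {ι : Type} [DecidableEq ι] (Ω : Set (Eu n))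
    (hfin : volume Ω < ⊤) (c : ι → Eu n) (r : ι → ℝ) (hr : ∀ i, 0 < r i)
    (hsub : ∀ i, ball (c i) (r i) ⊆ Ω)
    (hdisj : Pairwise (Function.onFun Disjoint fun i => ball (c i) (r i))) (lam : ℝ)
    (hlam : 1 ≤ lam) :
    ∃ σ : ℝ, 0 < σ ∧ ∀ F : Finset ι,
      ∫⁻ x in Ω, ENNReal.ofReal (Real.exp (σ * ∑ i ∈ F, cutW lam (c i) (r i) x))
        ≤ 2 * volume Ω := by
  obtain ⟨A, hA⟩ := variation c r hr hdisj lam hlam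
  obtain ⟨σ, hσ, hs⟩ := exists_sigma A ((2 * lam) ^ n)
  refine ⟨σ, hσ, ?_⟩
  set E : Finset ι → Eu n → ℝ≥0∞ := fun F x =>
    ENNReal.ofReal (Real.exp (σ * ∑ i ∈ F, cutW lam (c i) (r i) x)) with hE
  have hEm : ∀ F, Measurable (E F) := by
    intro F
    have : Continuous fun x => Real.exp (σ * ∑ i ∈ F, cutW lam (c i) (r i) x) := by
      have := fun i => cutW_continuous lam (c i) (r i)
      fun_prop
    exact this.measurable.ennreal_ofReal
  have hs1 : 0 ≤ Real.exp σ - 1 := by linarith [Real.add_one_le_exp σ]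
  have claim : ∀ F : Finset ι, ∫⁻ x in Ω, E F x ≤
      volume Ω + 2⁻¹ * ∑ i ∈ F, ∫⁻ x in ball (c i) (r i), E F x := by
    intro F
    induction F using Finset.induction_on_max_value (fun i => - r i) with
    | empty => simp [hE]
    | insert k F hk hmax ih =>
      have hrk := hr k
      have hmin : ∀ i ∈ F, r k ≤ r i := fun i hi => by linarith [hmax i hi]
      have hmono : ∀ x, E F x ≤ E (insert k F) x := by
        intro x
        simp only [hE]
        gcongr
        · intros; exact cutW_nonneg _ _ _ _
        · exact Finset.subset_insert _ _
      have hstep : ∀ x, E (insert k F) x ≤ E F x +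
          (ball (c k) (2 * lam * r k)).indicator
            (fun x => ENNReal.ofReal (Real.exp σ - 1) * E F x) x := by
        intro x
        simp only [hE]
        rw [Finset.sum_insert hk]
        by_cases hx : x ∈ ball (c k) (2 * lam * r k)
        · rw [indicator_of_mem hx, ← ENNReal.ofReal_mul hs1,
            ← ENNReal.ofReal_add (by positivity) (by positivity)]
          apply ENNReal.ofReal_le_ofReal
          rw [mul_add, Real.exp_add]
          have h1 : Real.exp (σ * cutW lam (c k) (r k) x) ≤ Real.exp σ := by
            apply Real.exp_le_exp.2
            have := cutW_le_one lam (c k) (r k) x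
            nlinarith
          have h2 := Real.exp_pos (σ * ∑ i ∈ F, cutW lam (c i) (r i) x)
          nlinarith
        · rw [indicator_of_notMem hx, add_zero]
          rw [mem_ball, not_lt] at hx
          rw [cutW_eq_zero (by linarith) hrk hx, zero_add]
      have hcomp : ∀ x y, dist x y ≤ 3 * lam * r k →
          E F x ≤ ENNReal.ofReal (Real.exp (σ * A)) * E F y := by
        intro x y hxy
        simp only [hE]
        rw [← ENNReal.ofReal_mul (by positivity), ← Real.exp_add, ← mul_add]
        apply ENNReal.ofReal_le_ofReal
        apply Real.exp_le_exp.2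
        apply mul_le_mul_of_nonneg_left _ hσ.le
        have := hA F (r k) hrk hmin x y hxy
        linarith
      have hlr : 0 < lam * r k := by positivity
      have hbig : ∫⁻ x in ball (c k) (2 * lam * r k), E F x ≤
          ENNReal.ofReal (Real.exp (σ * A)) * (ENNReal.ofReal ((2 * lam) ^ n) *
            ENNReal.ofReal (Real.exp (σ * A))) * ∫⁻ x in ball (c k) (r k), E F x := by
        have b1 : ∫⁻ x in ball (c k) (2 * lam * r k), E F x ≤
            ENNReal.ofReal (Real.exp (σ * A)) * E F (c k) * volume (ball (c k) (2 * lam * r k)) := by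
          rw [← setLIntegral_const]
          apply setLIntegral_mono' measurableSet_ball
          intro x hx
          apply hcomp
          rw [mem_ball] at hx
          linarith
        have b2 : E F (c k) * volume (ball (c k) (r k)) ≤
            ENNReal.ofReal (Real.exp (σ * A)) * ∫⁻ x in ball (c k) (r k), E F x := by
          rw [← setLIntegral_const, ← lintegral_const_mul _ (hEm F)]
          apply setLIntegral_mono' measurableSet_ball
          intro x hx
          apply hcomp
          rw [mem_ball, dist_comm] at hx
          nlinarith
        have b3 : volume (ball (c k) (2 * lam * r k)) =
            ENNReal.ofReal ((2 * lam) ^ n) * volume (ball (c k) (r k)) := by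
          rw [Measure.addHaar_ball_mul_of_pos _ _ (by linarith)]
          simp [Measure.addHaar_ball_center]
        calc _ ≤ _ := b1
          _ = ENNReal.ofReal (Real.exp (σ * A)) * ENNReal.ofReal ((2 * lam) ^ n) *
              (E F (c k) * volume (ball (c k) (r k))) := by rw [b3]; ring
          _ ≤ ENNReal.ofReal (Real.exp (σ * A)) * ENNReal.ofReal ((2 * lam) ^ n) *
              (ENNReal.ofReal (Real.exp (σ * A)) * ∫⁻ x in ball (c k) (r k), E F x) := by gcongr
          _ = _ := by ring
      have hcoef : ENNReal.ofReal (Real.exp σ - 1) * (ENNReal.ofReal (Real.exp (σ * A)) *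
          (ENNReal.ofReal ((2 * lam) ^ n) * ENNReal.ofReal (Real.exp (σ * A)))) ≤ 2⁻¹ := by
        rw [← ENNReal.ofReal_mul (by positivity), ← ENNReal.ofReal_mul (by positivity),
          ← ENNReal.ofReal_mul hs1]
        calc _ ≤ ENNReal.ofReal (1 / 2) := ENNReal.ofReal_le_ofReal hs
          _ = 2⁻¹ := by
            rw [one_div, ENNReal.ofReal_inv_of_pos (by norm_num)]; simp
      calc ∫⁻ x in Ω, E (insert k F) x
          ≤ ∫⁻ x in Ω, (E F x + (ball (c k) (2 * lam * r k)).indicator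
            (fun x => ENNReal.ofReal (Real.exp σ - 1) * E F x) x) := lintegral_mono hstep
        _ = (∫⁻ x in Ω, E F x) + ∫⁻ x in Ω, (ball (c k) (2 * lam * r k)).indicator
            (fun x => ENNReal.ofReal (Real.exp σ - 1) * E F x) x := lintegral_add_left (hEm F) _
        _ ≤ (∫⁻ x in Ω, E F x) + ∫⁻ x, (ball (c k) (2 * lam * r k)).indicator
            (fun x => ENNReal.ofReal (Real.exp σ - 1) * E F x) x := by
            gcongr
            exact Measure.restrict_le_self
        _ = (∫⁻ x in Ω, E F x) + ENNReal.ofReal (Real.exp σ - 1) *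
            ∫⁻ x in ball (c k) (2 * lam * r k), E F x := by
            rw [lintegral_indicator measurableSet_ball, lintegral_const_mul _ (hEm F)]
        _ ≤ (volume Ω + 2⁻¹ * ∑ i ∈ F, ∫⁻ x in ball (c i) (r i), E F x) +
            2⁻¹ * ∫⁻ x in ball (c k) (r k), E F x := by
            refine add_le_add ih ?_
            calc _ ≤ _ := mul_le_mul_right hbig _
              _ = _ := (mul_assoc _ _ _).symm
              _ ≤ _ := mul_le_mul_left hcoef _
        _ ≤ (volume Ω + 2⁻¹ * ∑ i ∈ F, ∫⁻ x in ball (c i) (r i), E (insert k F) x) +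
            2⁻¹ * ∫⁻ x in ball (c k) (r k), E (insert k F) x := by
            gcongr <;> exact hmono _
        _ = _ := by rw [Finset.sum_insert hk]; ring
  intro F
  have h1 := claim F
  have h2 : ∑ i ∈ F, ∫⁻ x in ball (c i) (r i), E F x ≤ ∫⁻ x in Ω, E F x := by
    rw [← lintegral_biUnion_finset (fun i _ j _ hij => hdisj hij) (fun i _ => measurableSet_ball)]
    apply lintegral_mono_set
    exact iUnion₂_subset fun i _ => hsub i
  have hfinE : ∫⁻ x in Ω, E F x < ⊤ := by
    calc ∫⁻ x in Ω, E F x ≤ ∫⁻ x in Ω, ENNReal.ofReal (Real.exp (σ * F.card)) := by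
          apply lintegral_mono
          intro x
          apply ENNReal.ofReal_le_ofReal
          apply Real.exp_le_exp.2
          apply mul_le_mul_of_nonneg_left _ hσ.le
          calc _ ≤ ∑ i ∈ F, (1:ℝ) := Finset.sum_le_sum fun i _ => cutW_le_one _ _ _ _
            _ = _ := by simp
      _ < ⊤ := by
          rw [setLIntegral_const]
          exact ENNReal.mul_lt_top ENNReal.ofReal_lt_top hfin
  set a := ∫⁻ x in Ω, E F x with ha
  have h3 : a ≤ volume Ω + 2⁻¹ * a := h1.trans (by gcongr)
  have h4 : a = 2⁻¹ * a + 2⁻¹ * a := by rw [← add_mul, ENNReal.inv_two_add_inv_two, one_mul]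
  have h5 : 2⁻¹ * a ≤ volume Ω := by
    have hne : 2⁻¹ * a ≠ ⊤ := (ENNReal.mul_lt_top (by simp) hfinE).ne
    nth_rewrite 1 [h4] at h3
    exact (ENNReal.add_le_add_iff_right hne).1 h3
  calc a = 2⁻¹ * a + 2⁻¹ * a := h4
    _ ≤ volume Ω + volume Ω := add_le_add h5 h5
    _ = _ := by ring

theorem exists_chain {n : ℕ} {Ω : Set (Eu n)} (hΩ : IsDomainEu Ω) (hp : Ωᶜ.Nonempty)
    {x₀ x : Eu n} (h0 : x₀ ∈ Ω) (hx : x ∈ Ω) :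
    ∃ xs : ℕ → Eu n, xs 0 = x ∧
      (∀ j ≤ ⌊qhDist Ω x₀ x⌋₊, xs j ∈ Ω ∧ qhDist Ω x₀ (xs j) = qhDist Ω x₀ x - j) ∧
      ∀ j < ⌊qhDist Ω x₀ x⌋₊, qhDist Ω (xs j) (xs (j + 1)) ≤ 2 := by
  have hP : ∀ y, ∃ z, (y ∈ Ω ∧ 1 ≤ qhDist Ω x₀ y) →
      z ∈ Ω ∧ qhDist Ω x₀ z = qhDist Ω x₀ y - 1 ∧ qhDist Ω y z ≤ 2 := by
    intro y
    by_cases h : y ∈ Ω ∧ 1 ≤ qhDist Ω x₀ y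
    · obtain ⟨z, h1, h2, h3⟩ := exists_pred hΩ hp h0 h.1 h.2
      exact ⟨z, fun _ => ⟨h1, h2, h3⟩⟩
    · exact ⟨y, fun h' => absurd h' h⟩
  choose P hP using hP
  set K := qhDist Ω x₀ x with hK
  have hK0 : 0 ≤ K := qhDist_nonneg _ _ _
  have hfl : (⌊K⌋₊ : ℝ) ≤ K := Nat.floor_le hK0
  have hge : ∀ j, j < ⌊K⌋₊ → 1 ≤ K - j := by
    intro j hj
    have : ((j + 1 : ℕ) : ℝ) ≤ ⌊K⌋₊ := by exact_mod_cast hj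
    push_cast at this
    linarith
  have main : ∀ j ≤ ⌊K⌋₊, P^[j] x ∈ Ω ∧ qhDist Ω x₀ (P^[j] x) = K - j := by
    intro j
    induction j with
    | zero => intro _; simp [hx, hK]
    | succ j ih =>
      intro hj
      obtain ⟨h1, h2⟩ := ih (by omega)
      obtain ⟨h3, h4, -⟩ := hP (P^[j] x) ⟨h1, by rw [h2]; exact hge j (by omega)⟩
      rw [Function.iterate_succ_apply']
      refine ⟨h3, ?_⟩
      rw [h4, h2]; push_cast; ring
  refine ⟨fun j => P^[j] x, rfl, main, ?_⟩
  intro j hj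
  obtain ⟨h1, h2⟩ := main j hj.le
  obtain ⟨-, -, h5⟩ := hP (P^[j] x) ⟨h1, by rw [h2]; exact hge j hj⟩
  simp only [Function.iterate_succ_apply']
  exact h5

theorem growth (δ : ℕ → ℝ) (M : ℕ) (hpos : ∀ j ≤ M, 0 < δ j)
    (hstep : ∀ j < M, δ (j + 1) ≤ Real.exp 2 * δ j) (ε : ℝ) (he0 : 0 ≤ ε) (he : ε ≤ 1 / 2) :
    ∀ j ≤ M, ∑ i ∈ Finset.range (j + 1), δ i ≤ δ 0 * Real.exp (2 * ε * j + 3 *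
      ((Finset.range (j + 1)).filter
        (fun i => ε * ∑ l ∈ Finset.range (i + 1), δ l ≤ δ i)).card) := by
  intro j
  induction j with
  | zero =>
    intro h
    have h0 := hpos 0 h
    rw [zero_add, Finset.sum_range_one]
    apply le_mul_of_one_le_right h0.le
    apply Real.one_le_exp
    positivity
  | succ j ih =>
    intro hj
    have ih := ih (by omega)
    have h0 := hpos 0 (by omega)
    have hj0 := hpos j (by omega)
    have hs := hstep j (by omega)
    have hT : δ j ≤ ∑ i ∈ Finset.range (j + 1), δ i := by
      rw [Finset.sum_range_succ]
      have : 0 ≤ ∑ i ∈ Finset.range j, δ i :=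
        Finset.sum_nonneg fun i hi => (hpos i (by rw [Finset.mem_range] at hi; omega)).le
      linarith
    rw [Finset.range_add_one (n := j + 1), Finset.filter_insert]
    split_ifs with hgood
    · rw [Finset.card_insert_of_notMem (by simp), Finset.sum_insert (by simp)]
      have e1 : 1 + Real.exp 2 ≤ Real.exp 3 := by
        have : Real.exp 3 = Real.exp 2 * Real.exp 1 := by rw [← Real.exp_add]; norm_num
        rw [this]
        have := Real.add_one_le_exp (1:ℝ)
        have := Real.add_one_le_exp (2:ℝ)
        nlinarith
      set T := ∑ i ∈ Finset.range (j + 1), δ i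
      set g := ((Finset.range (j + 1)).filter
        (fun i => ε * ∑ l ∈ Finset.range (i + 1), δ l ≤ δ i)).card
      have h1 : δ (j + 1) + T ≤ Real.exp 3 * T := by
        have := Real.exp_pos 2
        nlinarith
      calc δ (j + 1) + T ≤ Real.exp 3 * T := h1
        _ ≤ Real.exp 3 * (δ 0 * Real.exp (2 * ε * j + 3 * g)) := by gcongr
        _ = δ 0 * Real.exp (2 * ε * j + 3 * ((g + 1 : ℕ) : ℝ)) := by
            push_cast
            rw [show 2 * ε * j + 3 * ((g:ℝ) + 1) = 3 + (2 * ε * j + 3 * g) by ring,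
              Real.exp_add 3]
            ring
        _ ≤ _ := by
            gcongr
            simp
    · rw [not_le, Finset.range_add_one (n := j + 1), Finset.sum_insert (by simp)] at hgood
      rw [Finset.sum_insert (by simp)]
      set T := ∑ i ∈ Finset.range (j + 1), δ i
      set g := ((Finset.range (j + 1)).filter
        (fun i => ε * ∑ l ∈ Finset.range (i + 1), δ l ≤ δ i)).card
      have h2 : 1 ≤ (1 - ε) * Real.exp (2 * ε) := by
        have := Real.add_one_le_exp (2 * ε)
        nlinarith
      have hT0 : 0 < T := lt_of_lt_of_le hj0 hT
      have h1 : δ (j + 1) + T ≤ Real.exp (2 * ε) * T := by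
        have h3 : (δ (j + 1) + T) * (1 - ε) ≤ T := by linarith
        have h4 := hpos (j + 1) hj
        calc δ (j + 1) + T ≤ (δ (j + 1) + T) * ((1 - ε) * Real.exp (2 * ε)) :=
              le_mul_of_one_le_right (by linarith) h2
          _ = Real.exp (2 * ε) * ((δ (j + 1) + T) * (1 - ε)) := by ring
          _ ≤ _ := by gcongr
      calc δ (j + 1) + T ≤ Real.exp (2 * ε) * T := h1
        _ ≤ Real.exp (2 * ε) * (δ 0 * Real.exp (2 * ε * j + 3 * g)) := by gcongr
        _ = _ := by
            push_cast
            rw [show 2 * ε * ((j:ℝ) + 1) + 3 * (g:ℝ) = 2 * ε + (2 * ε * j + 3 * g) by ring,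
              Real.exp_add (2 * ε)]
            ring

/-- Facts on the chain from `x` to `x₀`. -/
theorem counting {n : ℕ} {Ω : Set (Eu n)} (hΩ : IsDomainEu Ω) (hp : Ωᶜ.Nonempty)
    {x₀ : Eu n} (h0 : x₀ ∈ Ω) (C : ℝ) (hC : 1 ≤ C)
    (hWC : ∀ x ∈ Ω, infDist x Ωᶜ ≤ C * Real.exp (-(qhDist Ω x₀ x / C))) :
    ∃ B D : ℝ, ∀ x ∈ Ω, dist x x₀ ≤ D ∧ ∃ (xs : ℕ → Eu n) (G : Finset ℕ),
      (∀ j ∈ G, xs j ∈ Ω ∧ qhDist Ω x₀ (xs j) = qhDist Ω x₀ x - j ∧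
        dist x (xs j) ≤ 4 * C * Real.exp 2 * infDist (xs j) Ωᶜ) ∧
      qhDist Ω x₀ x ≤ 6 * C * G.card + B := by
  have hC0 : 0 < C := by linarith
  have hd0 := infDist_pos_of_mem hΩ.1 hp h0
  set q := Real.exp (-(1 / C)) with hq
  have hq1 : q < 1 := by
    rw [hq, Real.exp_lt_one_iff]
    have : 0 < 1 / C := by positivity
    linarith
  refine ⟨2 * C * (Real.log C + 1 - Real.log (infDist x₀ Ωᶜ)),
    Real.exp 2 * (C / (1 - q)) + Real.exp 1 * C, ?_⟩
  intro x hx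
  obtain ⟨xs, hxs0, hxs, hstep⟩ := exists_chain hΩ hp h0 hx
  set K := qhDist Ω x₀ x with hK
  set M := ⌊K⌋₊ with hM
  have hK0 : 0 ≤ K := qhDist_nonneg _ _ _
  have hMK : (M:ℝ) ≤ K := Nat.floor_le hK0
  have hKM : K < M + 1 := Nat.lt_floor_add_one K
  set δ : ℕ → ℝ := fun j => infDist (xs j) Ωᶜ with hδ
  have hpos : ∀ j ≤ M, 0 < δ j := fun j hj => infDist_pos_of_mem hΩ.1 hp (hxs j hj).1
  have hδs : ∀ j < M, δ (j + 1) ≤ Real.exp 2 * δ j := by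
    intro j hj
    have := infDist_le_of_qhDist hΩ hp (hxs j hj.le).1 (hxs (j + 1) hj).1
    refine this.trans ?_
    have := Real.exp_le_exp.2 (hstep j hj)
    exact mul_le_mul_of_nonneg_right this (hpos j hj.le).le
  have hds : ∀ j < M, dist (xs j) (xs (j + 1)) ≤ Real.exp 2 * δ j := by
    intro j hj
    have := dist_le_of_qhDist hΩ hp (hxs j hj.le).1 (hxs (j + 1) hj).1
    refine this.trans ?_
    have := Real.exp_le_exp.2 (hstep j hj)
    exact mul_le_mul_of_nonneg_right (by linarith) (hpos j hj.le).le
  have hdist : ∀ j ≤ M, dist x (xs j) ≤ Real.exp 2 * ∑ i ∈ Finset.range (j + 1), δ i := by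
    intro j hj
    have h1 : dist (xs 0) (xs j) ≤ ∑ i ∈ Finset.range j, Real.exp 2 * δ i :=
      dist_le_range_sum_of_dist_le j (fun {k} hk => hds k (by omega))
    rw [hxs0, ← Finset.mul_sum] at h1
    refine h1.trans ?_
    rw [Finset.sum_range_succ]
    have := hpos j hj
    gcongr
    linarith
  have hkM : qhDist Ω (xs M) x₀ ≤ 1 := by
    rw [qhDist_comm, (hxs M le_rfl).2]; linarith
  constructor
  · -- boundedness
    have hT : ∀ j ≤ M, ∑ i ∈ Finset.range (j + 1), δ i ≤
        C / (1 - q) * Real.exp (-((K - j) / C)) := by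
      intro j
      induction j with
      | zero =>
        intro hj
        rw [zero_add, Finset.sum_range_one]
        have h1 := hWC (xs 0) (hxs 0 hj).1
        rw [(hxs 0 hj).2] at h1
        refine h1.trans ?_
        gcongr
        rw [le_div_iff₀ (by linarith)]
        have := Real.exp_pos (-(1 / C))
        nlinarith
      | succ j ih =>
        intro hj
        have ih := ih (by omega)
        rw [Finset.sum_range_succ]
        have h1 := hWC (xs (j + 1)) (hxs (j + 1) hj).1
        rw [(hxs (j + 1) hj).2] at h1
        have h2 : Real.exp (-((K - j) / C)) = q * Real.exp (-((K - ((j + 1 : ℕ) : ℝ)) / C)) := by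
          rw [hq, ← Real.exp_add]
          congr 1
          push_cast
          field_simp
          ring
        rw [h2] at ih
        set e := Real.exp (-((K - ((j + 1 : ℕ) : ℝ)) / C)) with he
        have h3 : C / (1 - q) * e = C / (1 - q) * (q * e) + C * e := by
          have : 1 - q ≠ 0 := by linarith
          field_simp
          ring
        rw [h3]
        exact add_le_add ih h1
    have h1 := hdist M le_rfl
    have h2 := hT M le_rfl
    have h3 : Real.exp (-((K - M) / C)) ≤ 1 := by
      rw [Real.exp_le_one_iff]
      have : 0 ≤ (K - M) / C := div_nonneg (by linarith) hC0.le
      linarith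
    have h4 : ∑ i ∈ Finset.range (M + 1), δ i ≤ C / (1 - q) := by
      refine h2.trans ?_
      apply mul_le_of_le_one_right _ h3
      exact div_nonneg hC0.le (by linarith)
    have h5 : dist (xs M) x₀ ≤ Real.exp 1 * C := by
      have a1 := dist_le_of_qhDist hΩ hp (hxs M le_rfl).1 h0
      refine a1.trans ?_
      have a2 := hWC _ (hxs M le_rfl).1
      have a3 : infDist (xs M) Ωᶜ ≤ C := by
        refine a2.trans (mul_le_of_le_one_right hC0.le ?_)
        rw [Real.exp_le_one_iff]
        have : 0 ≤ qhDist Ω x₀ (xs M) / C := div_nonneg (qhDist_nonneg _ _ _) hC0.le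
        linarith
      have a4 : Real.exp (qhDist Ω (xs M) x₀) ≤ Real.exp 1 := Real.exp_le_exp.2 hkM
      have a5 : 0 ≤ infDist (xs M) Ωᶜ := infDist_nonneg
      have a6 := Real.exp_pos 1
      apply mul_le_mul (by linarith) a3 a5 a6.le
    have h6 := dist_triangle x (xs M) x₀
    have h7 : Real.exp 2 * ∑ i ∈ Finset.range (M + 1), δ i ≤ Real.exp 2 * (C / (1 - q)) := by
      gcongr
    linarith
  · set ε := 1 / (4 * C) with hε
    have he0 : 0 < ε := by positivity
    have he1 : ε ≤ 1 / 2 := by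
      rw [hε, div_le_div_iff₀ (by positivity) (by norm_num)]
      linarith
    refine ⟨xs, (Finset.range (M + 1)).filter
        (fun i => ε * ∑ l ∈ Finset.range (i + 1), δ l ≤ δ i), ?_, ?_⟩
    · intro j hj
      rw [Finset.mem_filter, Finset.mem_range] at hj
      obtain ⟨hj1, hj2⟩ := hj
      have hjM : j ≤ M := by omega
      refine ⟨(hxs j hjM).1, (hxs j hjM).2, (hdist j hjM).trans ?_⟩
      have : ∑ l ∈ Finset.range (j + 1), δ l ≤ 4 * C * δ j := by
        rw [hε, one_div, inv_mul_le_iff₀ (by positivity)] at hj2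
        exact hj2
      calc _ ≤ Real.exp 2 * (4 * C * δ j) := by gcongr
        _ = _ := by simp only [hδ]; ring
    · have hg := growth δ M hpos hδs ε he0.le he1 M le_rfl
      set g := ((Finset.range (M + 1)).filter
        (fun i => ε * ∑ l ∈ Finset.range (i + 1), δ l ≤ δ i)).card
      have h1 : δ M ≤ ∑ i ∈ Finset.range (M + 1), δ i := by
        rw [Finset.sum_range_succ]
        have : 0 ≤ ∑ i ∈ Finset.range M, δ i :=
          Finset.sum_nonneg fun i hi => (hpos i (by rw [Finset.mem_range] at hi; omega)).le
        linarith
      have h2 : infDist x₀ Ωᶜ ≤ Real.exp 1 * δ M := by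
        refine (infDist_le_of_qhDist hΩ hp (hxs M le_rfl).1 h0).trans ?_
        exact mul_le_mul_of_nonneg_right (Real.exp_le_exp.2 hkM) infDist_nonneg
      have h3 : δ 0 ≤ C * Real.exp (-(K / C)) := by
        simp only [hδ, hxs0]; exact hWC x hx
      have h4 : infDist x₀ Ωᶜ ≤ C * Real.exp (1 + -(K / C) + (2 * ε * M + 3 * g)) := by
        rw [Real.exp_add, Real.exp_add]
        calc infDist x₀ Ωᶜ ≤ Real.exp 1 * δ M := h2
          _ ≤ Real.exp 1 * (δ 0 * Real.exp (2 * ε * M + 3 * g)) := by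
              gcongr; exact h1.trans hg
          _ ≤ Real.exp 1 * ((C * Real.exp (-(K / C))) * Real.exp (2 * ε * M + 3 * g)) := by
              gcongr
          _ = _ := by ring
      have h5 := Real.log_le_log hd0 h4
      rw [Real.log_mul hC0.ne' (Real.exp_pos _).ne', Real.log_exp] at h5
      have h6 : 2 * ε * M ≤ K / (2 * C) := by
        have : 2 * ε * M = M / (2 * C) := by rw [hε]; field_simp; ring
        rw [this]
        gcongr
      have h7 : K / C = 2 * (K / (2 * C)) := by field_simp
      have h8 : K / (2 * C) ≤ 3 * g + (Real.log C + 1 - Real.log (infDist x₀ Ωᶜ)) := by linarith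
      rw [div_le_iff₀ (by positivity)] at h8
      linarith

/-- A maximal family of disjoint Whitney type balls. -/
theorem exists_whitney {n : ℕ} (Ω : Set (Eu n)) :
    ∃ S : Set (Eu n), S ⊆ Ω ∧ S.PairwiseDisjoint (fun y => ball y (infDist y Ωᶜ / 16)) ∧
      ∀ x ∈ Ω, 0 < infDist x Ωᶜ → ∃ y ∈ S,
        dist x y ≤ (infDist x Ωᶜ + infDist y Ωᶜ) / 16 := by
  obtain ⟨S, hS⟩ := zorn_subset
    {S : Set (Eu n) | S ⊆ Ω ∧ S.PairwiseDisjoint (fun y => ball y (infDist y Ωᶜ / 16))} (by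
      intro c hc hchain
      refine ⟨⋃₀ c, ⟨sUnion_subset fun s hs => (hc hs).1, ?_⟩, fun s hs => subset_sUnion_of_mem hs⟩
      rw [pairwiseDisjoint_sUnion hchain.directedOn]
      exact fun s hs => (hc hs).2)
  refine ⟨S, hS.prop.1, hS.prop.2, ?_⟩
  intro x hx hd
  by_contra hcon
  push Not at hcon
  have hins : insert x S ∈
      {S : Set (Eu n) | S ⊆ Ω ∧ S.PairwiseDisjoint (fun y => ball y (infDist y Ωᶜ / 16))} := by
    refine ⟨insert_subset hx hS.prop.1, ?_⟩
    apply hS.prop.2.insert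
    intro y hy _
    apply ball_disjoint_ball
    have := hcon y hy
    linarith
  have hxS : x ∈ S := hS.le_of_ge hins (subset_insert _ _) (mem_insert _ _)
  have := hcon x hxS
  rw [dist_self] at this
  linarith

theorem integral_of_weakCarrot {n : ℕ} (Ω : Set (Eu n)) (hΩ : IsDomainEu Ω)
    (hp : Ωᶜ.Nonempty) (x₀ : Eu n) (hx₀ : x₀ ∈ Ω) (C : ℝ) (hC : 1 ≤ C)
    (h : ∀ x ∈ Ω, qhDist Ω x x₀ ≤ C * Real.log (C / infDist x Ωᶜ)) :
    ∃ σ : ℝ, 0 < σ ∧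
      (∫⁻ x in Ω, ENNReal.ofReal (Real.exp (σ * qhDist Ω x₀ x))) < ⊤ := by
  classical
  have hC0 : 0 < C := by linarith
  have hWC : ∀ x ∈ Ω, infDist x Ωᶜ ≤ C * Real.exp (-(qhDist Ω x₀ x / C)) := by
    intro x hx
    have hd := infDist_pos_of_mem hΩ.1 hp hx
    have h1 := h x hx
    rw [qhDist_comm, ← div_le_iff₀' hC0, Real.le_log_iff_exp_le (by positivity),
      le_div_iff₀ hd] at h1
    rw [Real.exp_neg, ← div_eq_mul_inv, le_div_iff₀ (Real.exp_pos _)]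
    linarith
  obtain ⟨B, D, hcount⟩ := counting hΩ hp hx₀ C hC hWC
  have hfin : volume Ω < ⊤ := by
    have : Ω ⊆ closedBall x₀ D := fun x hx => (hcount x hx).1
    exact lt_of_le_of_lt (measure_mono this) measure_closedBall_lt_top
  obtain ⟨S, hSΩ, hSd, hSm⟩ := exists_whitney Ω
  have hSpos : ∀ y : S, 0 < infDist (y : Eu n) Ωᶜ / 16 := fun y => by
    have := infDist_pos_of_mem hΩ.1 hp (hSΩ y.2)
    positivity
  have hScount : Countable S := by
    have : S.Countable := hSd.countable_of_isOpen (fun _ _ => isOpen_ball)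
      (fun y hy => ⟨y, mem_ball_self (hSpos ⟨y, hy⟩)⟩)
    exact this.to_subtype
  set lam := 20 * (4 * C * Real.exp 2 + 1) with hlam
  have hlam1 : 1 ≤ lam := by
    have : 0 ≤ 4 * C * Real.exp 2 := by positivity
    linarith
  obtain ⟨σ, hσ, hExpBound⟩ := exp_int Ω hfin (fun y : S => (y : Eu n))
    (fun y => infDist (y : Eu n) Ωᶜ / 16) hSpos
    (by
      intro y z hz
      rw [mem_ball, dist_comm] at hz
      have := hSpos y
      exact mem_of_dist_lt (by linarith))
    (by
      intro y z hyz
      exact hSd y.2 z.2 (fun h => hyz (Subtype.ext h)))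
    lam hlam1
  set E : Finset S → Eu n → ℝ≥0∞ := fun F x => ENNReal.ofReal (Real.exp (σ *
    ∑ i ∈ F, cutW lam (i : Eu n) (infDist (i : Eu n) Ωᶜ / 16) x)) with hE
  -- pointwise bound
  have hpt : ∀ x ∈ Ω, ∃ F : Finset S, qhDist Ω x₀ x ≤
      6 * C * (∑ i ∈ F, cutW lam (i : Eu n) (infDist (i : Eu n) Ωᶜ / 16) x) + B := by
    intro x hx
    obtain ⟨-, xs, G, hG, hle⟩ := hcount x hx
    have hnear : ∀ j, ∃ y : S, j ∈ G → qhDist Ω (xs j) y ≤ 2 / 13 ∧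
        dist x y ≤ lam * (infDist (y : Eu n) Ωᶜ / 16) := by
      intro j
      by_cases hj : j ∈ G
      · obtain ⟨h1, h2, h3⟩ := hG j hj
        have hd := infDist_pos_of_mem hΩ.1 hp h1
        obtain ⟨y, hy, hxy⟩ := hSm _ h1 hd
        refine ⟨⟨y, hy⟩, fun _ => ?_⟩
        have a1 := infDist_le_add Ωᶜ (xs j) y
        have a2 := infDist_le_add Ωᶜ y (xs j)
        rw [dist_comm] at a2
        have a3 : dist (xs j) y ≤ 2 / 15 * infDist (xs j) Ωᶜ := by linarith
        have a4 : infDist (xs j) Ωᶜ ≤ 15 / 13 * infDist y Ωᶜ := by linarith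
        constructor
        · refine (qhDist_le_of_dist hΩ.1 hp (by linarith)).trans ?_
          rw [div_le_iff₀ (by linarith)]
          linarith
        · have a5 := dist_triangle x (xs j) y
          have a6 : 0 ≤ 4 * C * Real.exp 2 := by positivity
          have a7 : dist x y ≤ (4 * C * Real.exp 2 + 1) * infDist (xs j) Ωᶜ := by linarith
          have a8 : (4 * C * Real.exp 2 + 1) * infDist (xs j) Ωᶜ ≤
              (4 * C * Real.exp 2 + 1) * (15 / 13 * infDist y Ωᶜ) := by gcongr
          have a9 : 0 ≤ (4 * C * Real.exp 2 + 1) * infDist y Ωᶜ :=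
            mul_nonneg (by linarith) infDist_nonneg
          rw [hlam]
          simp only
          linarith
      · obtain ⟨y, hy, -⟩ := hSm x hx (infDist_pos_of_mem hΩ.1 hp hx)
        exact ⟨⟨y, hy⟩, fun h' => absurd h' hj⟩
    choose f hf using hnear
    have hinj : Set.InjOn f G := by
      intro i hi j hj hij
      have b1 := (hf i hi).1
      have b2 := (hf j hj).1
      rw [hij] at b1
      obtain ⟨ci, di, -⟩ := hG i hi
      obtain ⟨cj, dj, -⟩ := hG j hj
      have hyΩ := hSΩ (f j).2
      have t1 := qhDist_triangle hΩ hp hx₀ ci hyΩ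
      have t2 := qhDist_triangle hΩ hp hx₀ hyΩ ci
      have t3 := qhDist_triangle hΩ hp hx₀ cj hyΩ
      have t4 := qhDist_triangle hΩ hp hx₀ hyΩ cj
      rw [qhDist_comm Ω (f j : Eu n)] at t2 t4
      have u1 : (i:ℝ) < j + 1 := by linarith
      have u2 : (j:ℝ) < i + 1 := by linarith
      have v1 : i < j + 1 := by exact_mod_cast u1
      have v2 : j < i + 1 := by exact_mod_cast u2
      omega
    refine ⟨G.image f, ?_⟩
    have hsum : ∑ i ∈ G.image f, cutW lam (i : Eu n) (infDist (i : Eu n) Ωᶜ / 16) x = G.card := by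
      rw [Finset.sum_image hinj, Finset.sum_congr rfl (g := fun _ => (1:ℝ))]
      · simp
      · intro j hj
        exact cutW_eq_one (by linarith) (hSpos (f j)) (hf j hj).2
    rw [hsum]
    exact hle
  refine ⟨σ / (6 * C), by positivity, ?_⟩
  have hEm : ∀ F, Measurable (E F) := by
    intro F
    have : Continuous fun x => Real.exp (σ *
        ∑ i ∈ F, cutW lam (i : Eu n) (infDist (i : Eu n) Ωᶜ / 16) x) := by
      have := fun i : S => cutW_continuous lam (i : Eu n) (infDist (i : Eu n) Ωᶜ / 16)
      fun_prop
    exact this.measurable.ennreal_ofReal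
  have hmono : ∀ F F', F ⊆ F' → E F ≤ E F' := by
    intro F F' hF x
    simp only [hE]
    apply ENNReal.ofReal_le_ofReal
    apply Real.exp_le_exp.2
    apply mul_le_mul_of_nonneg_left _ hσ.le
    exact Finset.sum_le_sum_of_subset_of_nonneg hF fun _ _ _ => cutW_nonneg _ _ _ _
  have hdir : Directed (· ≤ ·) E := fun F F' =>
    ⟨F ∪ F', hmono _ _ Finset.subset_union_left, hmono _ _ Finset.subset_union_right⟩
  calc ∫⁻ x in Ω, ENNReal.ofReal (Real.exp (σ / (6 * C) * qhDist Ω x₀ x))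
      ≤ ∫⁻ x in Ω, ENNReal.ofReal (Real.exp (σ / (6 * C) * B)) * ⨆ F, E F x := by
        apply setLIntegral_mono' hΩ.1.measurableSet
        intro x hx
        obtain ⟨F, hF⟩ := hpt x hx
        refine le_trans ?_ (mul_le_mul_right (le_iSup (fun F => E F x) F) _)
        simp only [hE]
        rw [← ENNReal.ofReal_mul (by positivity), ← Real.exp_add]
        apply ENNReal.ofReal_le_ofReal
        apply Real.exp_le_exp.2
        have hpos : 0 ≤ σ / (6 * C) := by positivity
        refine (mul_le_mul_of_nonneg_left hF hpos).trans (le_of_eq ?_)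
        field_simp
        ring
    _ = ENNReal.ofReal (Real.exp (σ / (6 * C) * B)) * ⨆ F, ∫⁻ x in Ω, E F x := by
        rw [lintegral_const_mul _ (Measurable.iSup hEm),
          lintegral_iSup_directed (fun F => (hEm F).aemeasurable) hdir]
    _ ≤ ENNReal.ofReal (Real.exp (σ / (6 * C) * B)) * (2 * volume Ω) := by
        gcongr
        exact iSup_le hExpBound
    _ < ⊤ := ENNReal.mul_lt_top ENNReal.ofReal_lt_top (ENNReal.mul_lt_top (by simp) hfin)

/-- A proper subdomain `Ω ⊆ ℝⁿ` is a weak carrot domain iff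
`∫_Ω exp(σ k_Ω(x₀, x)) dx < ∞` for some `σ > 0`. -/
theorem stmt9 {n : ℕ} (hn : 2 ≤ n) (Ω : Set (Eu n)) (hΩ : IsDomainEu Ω)
    (hproper : Ωᶜ.Nonempty) (x₀ : Eu n) (hx₀ : x₀ ∈ Ω) :
    IsWeakCarrot Ω ↔ ∃ σ : ℝ, 0 < σ ∧
      (∫⁻ x in Ω, ENNReal.ofReal (Real.exp (σ * qhDist Ω x₀ x))) < ⊤ := by
  constructor
  · rintro ⟨x₁, hx₁, C, hC, h⟩
    obtain ⟨σ, hσ, hI⟩ := integral_of_weakCarrot Ω hΩ hproper x₁ hx₁ C hC h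
    refine ⟨σ, hσ, ?_⟩
    calc ∫⁻ x in Ω, ENNReal.ofReal (Real.exp (σ * qhDist Ω x₀ x))
        ≤ ∫⁻ x in Ω, ENNReal.ofReal (Real.exp (σ * qhDist Ω x₀ x₁)) *
            ENNReal.ofReal (Real.exp (σ * qhDist Ω x₁ x)) := by
          apply setLIntegral_mono' hΩ.1.measurableSet
          intro x hx
          rw [← ENNReal.ofReal_mul (by positivity), ← Real.exp_add, ← mul_add]
          apply ENNReal.ofReal_le_ofReal
          apply Real.exp_le_exp.2
          exact mul_le_mul_of_nonneg_left (qhDist_triangle hΩ hproper hx₀ hx₁ hx) hσ.le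
      _ = ENNReal.ofReal (Real.exp (σ * qhDist Ω x₀ x₁)) *
            ∫⁻ x in Ω, ENNReal.ofReal (Real.exp (σ * qhDist Ω x₁ x)) :=
          lintegral_const_mul' _ _ ENNReal.ofReal_ne_top
      _ < ⊤ := ENNReal.mul_lt_top ENNReal.ofReal_lt_top hI
  · rintro ⟨σ, hσ, hI⟩
    exact weakCarrot_of_integral Ω hΩ hproper x₀ hx₀ hn σ hσ hI
end
end

section
/- Let n ≥ 2, Ω ⊆ ℝⁿ a domain, s ∈ (0,1], p ∈ (n/(n+s), ∞), and ρ ∈ (0,1). Then a measurable function u on Ω belongs to Ṁ^{s,p}_ball(Ω) if and only if inf_{g ∈ 𝒟^{s,ρ}_ball(u)} ‖g‖_{L^p(Ω)} < ∞. Moreover, there exists a constant C ≥ 1 (depending on n, s, p and ρ but not on u) such that for all u ∈ Ṁ^{s,p}_ball(Ω): C^{−1} ‖u‖_{Ṁ^{s,p}_ball(Ω)} ≤ inf_{g ∈ 𝒟^{s,ρ}_ball(u)} ‖g‖_{L^p(Ω)} ≤ C ‖u‖_{Ṁ^{s,p}_ball(Ω)}. -/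
open MeasureTheory Metric Set
open scoped ENNReal

noncomputable section

namespace HB

/-- averaging kernel -/
def K {n : ℕ} (Ω : Set (Eu n)) (a : ℝ) (x z : Eu n) : ℝ≥0∞ :=
  {q : Eu n × Eu n | dist q.1 q.2 < a * infDist q.1 Ωᶜ}.indicator
    (fun q => ENNReal.ofReal ((infDist q.1 Ωᶜ ^ n)⁻¹)) (x, z)

/-- averaged function -/
def G {n : ℕ} (Ω : Set (Eu n)) (a : ℝ) (f : Eu n → ℝ≥0∞) (x : Eu n) : ℝ≥0∞ :=
  ∫⁻ z, K Ω a x z * f z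

variable {n : ℕ} {Ω : Set (Eu n)} {a : ℝ}

lemma K_meas : Measurable (fun q : Eu n × Eu n => K Ω a q.1 q.2) := by
  unfold K
  have hd : Measurable (fun q : Eu n × Eu n => infDist q.1 Ωᶜ) :=
    ((continuous_infDist_pt _).comp continuous_fst).measurable
  apply Measurable.indicator
  · exact ((hd.pow_const n).inv).ennreal_ofReal
  · exact measurableSet_lt (continuous_dist.measurable) (hd.const_mul a)

lemma G_meas {f : Eu n → ℝ≥0∞} (hf : Measurable f) : Measurable (G Ω a f) := by
  unfold G
  exact Measurable.lintegral_prod_right' (f := fun q : Eu n × Eu n => K Ω a q.1 q.2 * f q.2)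
    (K_meas.mul (hf.comp measurable_snd))

lemma mem_of_close (ha : a ≤ 1/2) {x z : Eu n} (h : dist x z < a * infDist x Ωᶜ) : z ∈ Ω := by
  by_contra hz
  have h1 : infDist x Ωᶜ ≤ dist x z := infDist_le_dist_of_mem hz
  have h2 : 0 ≤ infDist x Ωᶜ := infDist_nonneg
  nlinarith

lemma K_le (ha : a ≤ 1/2) (x z : Eu n) :
    K Ω a x z ≤ Ω.indicator (fun _ => ENNReal.ofReal ((infDist x Ωᶜ ^ n)⁻¹)) z := by
  unfold K
  by_cases h : dist x z < a * infDist x Ωᶜ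
  · rw [indicator_of_mem (by exact h), indicator_of_mem (mem_of_close ha h)]
  · rw [indicator_of_notMem (by exact h)]; exact zero_le

lemma G_lt_top (hO : IsOpen Ω) (ha : a ≤ 1/2) {f : Eu n → ℝ≥0∞} (hf : ∫⁻ z in Ω, f z ≠ ⊤)
    (x : Eu n) : G Ω a f x ≠ ⊤ := by
  refine ne_top_of_le_ne_top (b := ENNReal.ofReal ((infDist x Ωᶜ ^ n)⁻¹) * ∫⁻ z in Ω, f z)
    (ENNReal.mul_ne_top ENNReal.ofReal_ne_top hf) ?_
  rw [← lintegral_const_mul' _ _ ENNReal.ofReal_ne_top, ← lintegral_indicator hO.measurableSet]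
  refine lintegral_mono fun z => ?_
  refine (mul_le_mul_left (K_le ha x z) (f z)).trans ?_
  by_cases h : z ∈ Ω <;> simp [h]

lemma int_K_le (ha : a ≤ 1/2) (z : Eu n) :
    ∫⁻ x, K Ω a x z ≤
      Ω.indicator (fun _ => ENNReal.ofReal (2^n) * volume (ball (0 : Eu n) 1)) z := by
  by_cases hz : z ∈ Ω ∧ 0 < infDist z Ωᶜ
  · obtain ⟨hz, hd⟩ := hz
    rw [indicator_of_mem hz]
    have key : ∀ x, K Ω a x z ≤ (ball z (infDist z Ωᶜ)).indicator
        (fun _ => ENNReal.ofReal (2^n * (infDist z Ωᶜ ^ n)⁻¹)) x := by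
      intro x
      unfold K
      by_cases h : dist x z < a * infDist x Ωᶜ
      · have h1 : infDist x Ωᶜ ≤ infDist z Ωᶜ + dist x z := infDist_le_infDist_add_dist
        have h1' : infDist z Ωᶜ ≤ infDist x Ωᶜ + dist z x := infDist_le_infDist_add_dist
        rw [dist_comm z x] at h1'
        have h2 : 0 ≤ infDist x Ωᶜ := infDist_nonneg
        have h3 : dist x z < infDist z Ωᶜ := by nlinarith
        have h4 : infDist z Ωᶜ ≤ 2 * infDist x Ωᶜ := by nlinarith
        rw [indicator_of_mem (by exact h), indicator_of_mem (by exact h3)]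
        apply ENNReal.ofReal_le_ofReal
        have h5 : 0 < infDist x Ωᶜ := by linarith
        rw [← div_eq_mul_inv, ← div_pow, ← inv_pow]
        apply pow_le_pow_left₀ (by positivity)
        rw [inv_eq_one_div, div_le_div_iff₀ h5 hd]
        linarith
      · rw [indicator_of_notMem (by exact h)]; exact zero_le
    refine (lintegral_mono key).trans ?_
    rw [lintegral_indicator measurableSet_ball, setLIntegral_const,
      Measure.addHaar_ball_of_pos _ _ hd, ← mul_assoc, ← ENNReal.ofReal_mul (by positivity)]
    simp only [finrank_euclideanSpace, Fintype.card_fin]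
    rw [mul_assoc, inv_mul_cancel₀ (by positivity), mul_one]
  · have : ∀ x, K Ω a x z = 0 := by
      intro x
      unfold K
      apply indicator_of_notMem
      intro h
      have h : dist x z < a * infDist x Ωᶜ := h
      apply hz ⟨mem_of_close ha h, ?_⟩
      have h1 : infDist x Ωᶜ ≤ infDist z Ωᶜ + dist x z := infDist_le_infDist_add_dist
      have h2 : 0 ≤ infDist x Ωᶜ := infDist_nonneg
      have h3 : 0 ≤ dist x z := dist_nonneg
      nlinarith
    simp [this]

lemma swap_gen {X : Type*} [MeasurableSpace X] (μ : Measure X) [SFinite μ]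
    (k : X → X → ℝ≥0∞) (hk : Measurable (fun q : X × X => k q.1 q.2)) {f : X → ℝ≥0∞}
    (hf : Measurable f) :
    ∫⁻ x, ∫⁻ z, k x z * f z ∂μ ∂μ = ∫⁻ z, (∫⁻ x, k x z ∂μ) * f z ∂μ := by
  have hu : Measurable (Function.uncurry fun x z => k x z * f z) :=
    hk.mul (hf.comp measurable_snd)
  rw [lintegral_lintegral_swap hu.aemeasurable]
  refine lintegral_congr fun z => ?_
  have hm : Measurable (fun x => k x z) := hk.comp (measurable_id.prodMk measurable_const)
  exact lintegral_mul_const _ hm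

lemma G_swap {f : Eu n → ℝ≥0∞} (hf : Measurable f) :
    ∫⁻ x, G Ω a f x = ∫⁻ z, (∫⁻ x, K Ω a x z) * f z :=
  swap_gen volume (K Ω a) K_meas hf

lemma int_G_le_aux (hO : IsOpen Ω) {f : Eu n → ℝ≥0∞} (hf : Measurable f) (M : ℝ≥0∞)
    (hM : ∀ z, ∫⁻ x, K Ω a x z ≤ Ω.indicator (fun _ => M) z) :
    ∫⁻ x in Ω, G Ω a f x ≤ M * ∫⁻ z in Ω, f z := by
  refine (setLIntegral_le_lintegral _ _).trans ?_
  rw [G_swap hf, ← lintegral_const_mul _ hf, ← lintegral_indicator hO.measurableSet]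
  refine lintegral_mono fun z => ?_
  refine (mul_le_mul_left (hM z) (f z)).trans ?_
  by_cases h : z ∈ Ω
  · rw [indicator_of_mem h, indicator_of_mem h]
  · rw [indicator_of_notMem h, indicator_of_notMem h, zero_mul]

lemma int_G_le (hO : IsOpen Ω) (ha : a ≤ 1/2) {f : Eu n → ℝ≥0∞} (hf : Measurable f) :
    ∫⁻ x in Ω, G Ω a f x ≤
      ENNReal.ofReal (2^n) * volume (ball (0 : Eu n) 1) * ∫⁻ z in Ω, f z :=
  int_G_le_aux hO hf _ (int_K_le ha)

/-- a good point in a small ball -/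
lemma exists_good {f : Eu n → ℝ≥0∞} (hf : Measurable f) {N : Set (Eu n)} (hN : volume N = 0)
    {ε : ℝ} (hε : 0 < ε) {x m : Eu n} (hd : 0 < infDist x Ωᶜ)
    (hsub : ball m (ε * infDist x Ωᶜ) ⊆ ball x (a * infDist x Ωᶜ)) :
    ∃ z ∈ ball m (ε * infDist x Ωᶜ), z ∉ N ∧
      f z ≤ (ENNReal.ofReal (ε^n) * volume (ball (0 : Eu n) 1))⁻¹ * G Ω a f x := by
  set r := ε * infDist x Ωᶜ with hr
  have hr0 : 0 < r := by positivity
  have hv0 : volume (ball m r) ≠ 0 := (measure_ball_pos _ _ hr0).ne'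
  have hvt : volume (ball m r) ≠ ⊤ := measure_ball_lt_top.ne
  have : IsFiniteMeasure (volume.restrict (ball m r)) :=
    isFiniteMeasure_restrict.2 hvt
  have hN' : (volume.restrict (ball m r)) (N ∪ (ball m r)ᶜ) = 0 := by
    refine measure_union_null (le_antisymm ((Measure.restrict_apply_le _ _).trans hN.le) zero_le) ?_
    rw [Measure.restrict_apply measurableSet_ball.compl]; simp
  obtain ⟨z, hz, hfz⟩ := exists_notMem_null_le_laverage (μ := volume.restrict (ball m r))
    (by simpa [Measure.restrict_eq_zero] using hv0) hf.aemeasurable hN'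
  simp only [mem_union, not_or, mem_compl_iff, not_not] at hz
  refine ⟨z, hz.2, hz.1, hfz.trans ?_⟩
  rw [setLAverage_eq, ENNReal.div_eq_inv_mul, Measure.addHaar_ball_of_pos _ _ hr0]
  simp only [finrank_euclideanSpace, Fintype.card_fin]
  have hc0 : volume (ball (0 : Eu n) 1) ≠ 0 := (measure_ball_pos _ _ one_pos).ne'
  have hct : volume (ball (0 : Eu n) 1) ≠ ⊤ := measure_ball_lt_top.ne
  have e1 : (ENNReal.ofReal (r^n) * volume (ball (0 : Eu n) 1))⁻¹ =
      (ENNReal.ofReal (ε^n) * volume (ball (0 : Eu n) 1))⁻¹ *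
        ENNReal.ofReal ((infDist x Ωᶜ ^ n)⁻¹) := by
    rw [hr, mul_pow, ENNReal.ofReal_mul (by positivity), ENNReal.ofReal_inv_of_pos (by positivity),
      ← ENNReal.mul_inv (Or.inr ENNReal.ofReal_ne_top)
        (Or.inl (ENNReal.mul_ne_top ENNReal.ofReal_ne_top hct))]
    congr 1; ring
  rw [e1, mul_assoc]
  gcongr
  unfold G
  rw [← lintegral_const_mul _ hf, ← lintegral_indicator measurableSet_ball]
  refine lintegral_mono fun w => ?_
  by_cases hw : w ∈ ball m r
  · rw [indicator_of_mem hw]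
    have : dist x w < a * infDist x Ωᶜ := by
      rw [dist_comm]; exact hsub hw
    unfold K
    rw [indicator_of_mem (by exact this)]
  · rw [indicator_of_notMem hw]; exact zero_le

lemma cond_iff (hne : Ωᶜ.Nonempty) {ρ : ℝ} (hρ : 0 < ρ) (x y : Eu n) :
    edist x y < ENNReal.ofReal ρ * Metric.infEDist x Ωᶜ ↔ dist x y < ρ * infDist x Ωᶜ := by
  have : Metric.infEDist x Ωᶜ = ENNReal.ofReal (infDist x Ωᶜ) :=
    (ENNReal.ofReal_toReal (infEDist_ne_top hne)).symm
  rw [this, ← ENNReal.ofReal_mul hρ.le, edist_dist, ENNReal.ofReal_lt_ofReal_iff']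
  refine ⟨fun h => h.1, fun h => ⟨h, lt_of_le_of_lt dist_nonneg h⟩⟩

/-- `ρ'`-seminorm controlled by the `ρ`-seminorm. -/
def Ctl (Ω : Set (Eu n)) (s p ρ ρ' : ℝ) : Prop :=
  ∃ C : ℝ, 1 ≤ C ∧ ∀ u : Eu n → ℝ, ballNormRho Ω s p ρ' u ≤ ENNReal.ofReal C * ballNormRho Ω s p ρ u

lemma Ctl.trans {s p r1 r2 r3 : ℝ} (h1 : Ctl Ω s p r1 r2) (h2 : Ctl Ω s p r2 r3) :
    Ctl Ω s p r1 r3 := by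
  obtain ⟨C, hC, h⟩ := h1
  obtain ⟨D, hD, k⟩ := h2
  refine ⟨D * C, one_le_mul_of_one_le_of_one_le hD hC, fun u => (k u).trans ?_⟩
  rw [ENNReal.ofReal_mul (by linarith), mul_assoc]
  gcongr
  exact h u

lemma ctl_of_subset {s p ρ ρ' : ℝ} (h : ∀ u, DBall Ω s ρ u ⊆ DBall Ω s ρ' u) :
    Ctl Ω s p ρ ρ' := by
  refine ⟨1, le_rfl, fun u => ?_⟩
  rw [ENNReal.ofReal_one, one_mul]
  exact biInf_mono (h u)

lemma ctl_mono {s p ρ ρ' : ℝ} (h : ρ' ≤ ρ) : Ctl Ω s p ρ ρ' := by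
  refine ctl_of_subset fun u g hg => ?_
  obtain ⟨h1, h2, N, h3, h4, h5⟩ := hg
  refine ⟨h1, h2, N, h3, h4, fun x hx y hy hxy => h5 x hx y hy (hxy.trans_le ?_)⟩
  gcongr

lemma ctl_univ (he : Ωᶜ = ∅) {s p ρ ρ' : ℝ} (hρ : 0 < ρ) : Ctl Ω s p ρ ρ' := by
  refine ctl_of_subset fun u g hg => ?_
  obtain ⟨h1, h2, N, h3, h4, h5⟩ := hg
  refine ⟨h1, h2, N, h3, h4, fun x hx y hy hxy => h5 x hx y hy ?_⟩
  have : EMetric.infEdist x Ωᶜ = ⊤ := by rw [he]; exact infEDist_empty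
  rw [this, ENNReal.mul_top (by simpa using hρ)]
  exact edist_lt_top _ _

lemma eLpNorm_eq {p : ℝ} (hp : 0 < p) (g : Eu n → ℝ) :
    eLpNorm g (ENNReal.ofReal p) (volume.restrict Ω) = (∫⁻ z in Ω, ‖g z‖ₑ ^ p) ^ (1 / p) := by
  rw [eLpNorm_eq_lintegral_rpow_enorm_toReal (by simpa using hp) ENNReal.ofReal_ne_top,
    ENNReal.toReal_ofReal hp.le]

lemma ctl_step (hO : IsOpen Ω) (hne : Ωᶜ.Nonempty) {s p ρ ρ' : ℝ} (hs : 0 < s) (hp : 0 < p)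
    (hρ : 0 < ρ) (hρ1 : ρ < 1) (hρ' : 0 < ρ') (h : ρ' * (1 + ρ) < 2 * ρ) : Ctl Ω s p ρ ρ' := by
  obtain ⟨a, haρ⟩ : ∃ a : ℝ, a * (1 + ρ) = ρ := ⟨ρ / (1 + ρ), by field_simp⟩
  have ha2 : a ≤ 1/2 := by nlinarith
  have ha0 : 0 < a := by nlinarith
  have haρ2 : a ≤ ρ := by nlinarith
  obtain ⟨ε, hεa⟩ : ∃ ε : ℝ, ε = a - ρ' / 2 := ⟨_, rfl⟩
  have hε : 0 < ε := by
    have : ρ' * (1 + ρ) < 2 * a * (1 + ρ) := by linarith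
    have := lt_of_mul_lt_mul_right this (by linarith)
    linarith
  have hc0 : volume (ball (0 : Eu n) 1) ≠ 0 := (measure_ball_pos _ _ one_pos).ne'
  have hct : volume (ball (0 : Eu n) 1) ≠ ⊤ := measure_ball_lt_top.ne
  obtain ⟨κ, hκ⟩ : ∃ κ, κ = (ENNReal.ofReal (ε^n) * volume (ball (0 : Eu n) 1))⁻¹ := ⟨_, rfl⟩
  have hκt : κ ≠ ⊤ := by
    rw [hκ]
    refine ENNReal.inv_ne_top.2 (mul_ne_zero ?_ hc0)
    simpa using pow_pos hε n
  obtain ⟨Λ, hΛ⟩ : ∃ Λ, Λ = ENNReal.ofReal (2^n) * volume (ball (0 : Eu n) 1) := ⟨_, rfl⟩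
  have hΛt : Λ ≠ ⊤ := by rw [hΛ]; exact ENNReal.mul_ne_top ENNReal.ofReal_ne_top hct
  obtain ⟨D, hD⟩ : ∃ D, D = ENNReal.LpAddConst (ENNReal.ofReal p) * (1 + 2 * (κ * Λ) ^ (1 / p)) :=
    ⟨_, rfl⟩
  have hDt : D ≠ ⊤ := by
    rw [hD]
    refine ENNReal.mul_ne_top (ENNReal.LpAddConst_lt_top _).ne (ENNReal.add_ne_top.2 ⟨by simp, ?_⟩)
    exact ENNReal.mul_ne_top (by simp)
      (ENNReal.rpow_ne_top_of_nonneg (by positivity) (ENNReal.mul_ne_top hκt hΛt))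
  have hDC : D ≤ ENNReal.ofReal (max 1 D.toReal) := by
    rw [← ENNReal.ofReal_toReal hDt]
    apply ENNReal.ofReal_le_ofReal
    simp
  refine ⟨max 1 D.toReal, le_max_left _ _, fun u => ?_⟩
  have hC0 : ENNReal.ofReal (max 1 D.toReal) ≠ 0 := by simp
  conv_rhs => unfold ballNormRho
  rw [ENNReal.mul_iInf_of_ne hC0 ENNReal.ofReal_ne_top]
  refine le_iInf fun g => ?_
  rw [ENNReal.mul_iInf_of_ne hC0 ENNReal.ofReal_ne_top]
  refine le_iInf fun hg => ?_
  obtain ⟨hgm, hg0, N, hNΩ, hN0, hgN⟩ := hg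
  by_cases hfin : eLpNorm g (ENNReal.ofReal p) (volume.restrict Ω) = ⊤
  · rw [hfin, ENNReal.mul_top hC0]; exact le_top
  refine le_trans ?_ (mul_le_mul_left hDC _)
  obtain ⟨f, hf⟩ : ∃ f : Eu n → ℝ≥0∞, f = fun z => ‖g z‖ₑ ^ p := ⟨_, rfl⟩
  have hfm : Measurable f := by rw [hf]; exact hgm.enorm.pow_const p
  have hgf : eLpNorm g (ENNReal.ofReal p) (volume.restrict Ω) = (∫⁻ z in Ω, f z) ^ (1 / p) := by
    rw [eLpNorm_eq hp, hf]
  have hfi : ∫⁻ z in Ω, f z ≠ ⊤ := by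
    intro htop
    apply hfin
    rw [hgf, htop, ENNReal.top_rpow_of_pos (by positivity)]
  have hGt : ∀ x, G Ω a f x ≠ ⊤ := G_lt_top hO ha2 hfi
  have hGm : Measurable (G Ω a f) := G_meas hfm
  obtain ⟨h', hh'⟩ : ∃ h' : Eu n → ℝ≥0∞, h' = fun x => 2 * (κ * G Ω a f x) ^ (1 / p) := ⟨_, rfl⟩
  have hh't : ∀ x, h' x ≠ ⊤ := by
    intro x
    rw [hh']
    exact ENNReal.mul_ne_top (by simp)
      (ENNReal.rpow_ne_top_of_nonneg (by positivity) (ENNReal.mul_ne_top hκt (hGt x)))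
  have hh'm : Measurable h' := by
    rw [hh']; exact ((hGm.const_mul κ).pow_const _).const_mul 2
  have hhm : Measurable (fun x => (h' x).toReal) := hh'm.ennreal_toReal
  have hmem : (g + fun x => (h' x).toReal) ∈ DBall Ω s ρ' u := by
    refine ⟨hgm.add hhm, fun x => add_nonneg (hg0 x) ENNReal.toReal_nonneg, N, hNΩ, hN0, ?_⟩
    intro x hx y hy hxy
    replace hxy := (cond_iff hne hρ' x y).1 hxy
    have hgN' : ∀ x ∈ Ω \ N, ∀ y ∈ Ω \ N, dist x y < ρ * infDist x Ωᶜ →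
        |u x - u y| ≤ dist x y ^ s * (g x + g y) := fun x hx y hy hxy =>
      hgN x hx y hy ((cond_iff hne hρ x y).2 hxy)
    have hhx : 0 ≤ (h' x).toReal := ENNReal.toReal_nonneg
    have hhy : 0 ≤ (h' y).toReal := ENNReal.toReal_nonneg
    have hds : 0 ≤ dist x y ^ s := Real.rpow_nonneg dist_nonneg _
    simp only [Pi.add_apply]
    by_cases hclose : dist x y < ρ * infDist x Ωᶜ
    · refine (hgN' x hx y hy hclose).trans (mul_le_mul_of_nonneg_left (by linarith) hds)
    push Not at hclose
    have hd0 : 0 < infDist x Ωᶜ := by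
      have : 0 ≤ infDist x Ωᶜ := infDist_nonneg
      have h3 : 0 ≤ dist x y := dist_nonneg
      nlinarith
    have hmx : dist (midpoint ℝ x y) x = dist x y / 2 := by
      rw [dist_midpoint_left]; norm_num; ring
    have hmy : dist (midpoint ℝ x y) y = dist x y / 2 := by
      rw [dist_midpoint_right]; norm_num; ring
    have hwx : ∀ w ∈ ball (midpoint ℝ x y) (ε * infDist x Ωᶜ), dist x w < a * infDist x Ωᶜ := by
      intro w hw
      have h1 : dist w (midpoint ℝ x y) < ε * infDist x Ωᶜ := hw
      have h2 := dist_triangle w (midpoint ℝ x y) x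
      rw [dist_comm x w]
      rw [hεa] at h1
      nlinarith
    have hwy : ∀ w ∈ ball (midpoint ℝ x y) (ε * infDist x Ωᶜ), dist w y < a * infDist x Ωᶜ := by
      intro w hw
      have h1 : dist w (midpoint ℝ x y) < ε * infDist x Ωᶜ := hw
      have h2 := dist_triangle w (midpoint ℝ x y) y
      rw [hεa] at h1
      nlinarith
    obtain ⟨z, hz, hzN, hfz⟩ := exists_good (a := a) hfm hN0 hε hd0
      (fun w hw => by rw [mem_ball, dist_comm]; exact hwx w hw)
    rw [← hκ] at hfz
    have hxz := hwx z hz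
    have hzy := hwy z hz
    have hzΩ : z ∈ Ω \ N := ⟨mem_of_close ha2 hxz, hzN⟩
    have hgz : 2 * g z ≤ (h' x).toReal := by
      have h1 : ‖g z‖ₑ ≤ (κ * G Ω a f x) ^ (1 / p) := by
        rw [one_div, ENNReal.le_rpow_inv_iff hp]
        rw [hf] at hfz ⊢
        exact hfz
      have h2 : 2 * ‖g z‖ₑ ≤ h' x := by
        rw [hh']; exact mul_le_mul_right h1 2
      have h3 := ENNReal.toReal_mono (hh't x) h2
      rw [ENNReal.toReal_mul, toReal_enorm, Real.norm_of_nonneg (hg0 z)] at h3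
      simpa using h3
    have hle : a * infDist x Ωᶜ ≤ dist x y :=
      (mul_le_mul_of_nonneg_right haρ2 hd0.le).trans hclose
    have b1 := hgN' x hx z hzΩ (hxz.trans_le (mul_le_mul_of_nonneg_right haρ2 hd0.le))
    have b2 := hgN' z hzΩ y hy (by
      have h1 : infDist x Ωᶜ ≤ infDist z Ωᶜ + dist x z := infDist_le_infDist_add_dist
      have h2 : ρ * ((1 - a) * infDist x Ωᶜ) ≤ ρ * infDist z Ωᶜ :=
        mul_le_mul_of_nonneg_left (by linarith) hρ.le
      have h3 : ρ * ((1 - a) * infDist x Ωᶜ) = a * infDist x Ωᶜ := by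
        have : ρ * (1 - a) = a := by linarith
        rw [← mul_assoc, this]
      linarith)
    have c1 : dist x z ^ s ≤ dist x y ^ s :=
      Real.rpow_le_rpow dist_nonneg (hxz.le.trans hle) hs.le
    have c2 : dist z y ^ s ≤ dist x y ^ s :=
      Real.rpow_le_rpow dist_nonneg (hzy.le.trans hle) hs.le
    have c3 : dist x z ^ s * (g x + g z) ≤ dist x y ^ s * (g x + g z) :=
      mul_le_mul_of_nonneg_right c1 (add_nonneg (hg0 _) (hg0 _))
    have c4 : dist z y ^ s * (g z + g y) ≤ dist x y ^ s * (g z + g y) :=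
      mul_le_mul_of_nonneg_right c2 (add_nonneg (hg0 _) (hg0 _))
    have c5 := abs_sub_le (u x) (u z) (u y)
    have c6 : dist x y ^ s * (g x + g z) + dist x y ^ s * (g z + g y) ≤
        dist x y ^ s * (g x + (h' x).toReal + (g y + (h' y).toReal)) := by
      rw [← mul_add]
      exact mul_le_mul_of_nonneg_left (by linarith) hds
    linarith
  refine (iInf₂_le _ hmem).trans ?_
  refine (eLpNorm_add_le' hgm.aestronglyMeasurable hhm.aestronglyMeasurable _).trans ?_
  rw [hD, mul_assoc, add_mul, one_mul]
  gcongr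
  rw [hgf, eLpNorm_eq hp]
  have e1 : ∀ x, ‖(h' x).toReal‖ₑ ^ p = 2 ^ p * κ * G Ω a f x := by
    intro x
    rw [Real.enorm_of_nonneg ENNReal.toReal_nonneg, ENNReal.ofReal_toReal (hh't x), hh']
    simp only
    rw [ENNReal.mul_rpow_of_nonneg _ _ hp.le, ← ENNReal.rpow_mul, one_div_mul_cancel hp.ne',
      ENNReal.rpow_one, mul_assoc]
  simp only [e1]
  rw [lintegral_const_mul _ hGm]
  have e2 := int_G_le hO ha2 hfm
  rw [← hΛ] at e2
  calc (2 ^ p * κ * ∫⁻ x in Ω, G Ω a f x) ^ (1 / p)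
      ≤ (2 ^ p * κ * (Λ * ∫⁻ z in Ω, f z)) ^ (1 / p) := by gcongr
    _ = (2 ^ p * ((κ * Λ) * ∫⁻ z in Ω, f z)) ^ (1 / p) := by
        congr 1; ring
    _ = 2 * (κ * Λ) ^ (1 / p) * (∫⁻ z in Ω, f z) ^ (1 / p) := by
        rw [ENNReal.mul_rpow_of_nonneg _ _ (by positivity),
          ENNReal.mul_rpow_of_nonneg _ _ (by positivity), ← ENNReal.rpow_mul,
          mul_one_div_cancel hp.ne', ENNReal.rpow_one, mul_assoc]

lemma ctl_iter (hO : IsOpen Ω) (hne : Ωᶜ.Nonempty) {s p t : ℝ} (hs : 0 < s) (hp : 0 < p)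
    (ht : 0 < t) (k : ℕ) : Ctl Ω s p (1 + t)⁻¹ (1 + (3/4)^k * t)⁻¹ := by
  induction k with
  | zero => simpa using ctl_mono le_rfl
  | succ k ih =>
    refine ih.trans ?_
    obtain ⟨q, hq⟩ : ∃ q, q = (3/4 : ℝ)^k * t := ⟨_, rfl⟩
    have hq0 : 0 < q := by rw [hq]; positivity
    have e : (3/4 : ℝ)^(k+1) * t = 3/4 * q := by rw [hq]; ring
    rw [e, ← hq]
    refine ctl_step hO hne hs hp (by positivity) (inv_lt_one_of_one_lt₀ (by linarith))
      (by positivity) ?_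
    have h1 : (1 + 3/4 * q)⁻¹ * (1 + (1 + q)⁻¹) = (2 + q) / ((1 + 3/4 * q) * (1 + q)) := by
      field_simp; ring
    rw [h1, ← div_eq_mul_inv, div_lt_div_iff₀ (by positivity) (by positivity)]
    nlinarith [mul_pos hq0 hq0]

lemma ctl_all (hO : IsOpen Ω) {s p ρ ρ' : ℝ} (hs : 0 < s) (hp : 0 < p)
    (hρ : 0 < ρ) (hρ1 : ρ < 1) (hρ'0 : 0 < ρ') (hρ'1 : ρ' < 1) : Ctl Ω s p ρ ρ' := by
  rcases eq_empty_or_nonempty Ωᶜ with he | hne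
  · exact ctl_univ he hρ
  have ht : 0 < ρ⁻¹ - 1 := by linarith [one_lt_inv_iff₀.2 ⟨hρ, hρ1⟩]
  have ht' : 0 < ρ'⁻¹ - 1 := by linarith [one_lt_inv_iff₀.2 ⟨hρ'0, hρ'1⟩]
  obtain ⟨k, hk⟩ := exists_pow_lt_of_lt_one (div_pos ht' ht) (show (3/4 : ℝ) < 1 by norm_num)
  rw [lt_div_iff₀ ht] at hk
  have h1 := ctl_iter (Ω := Ω) hO hne hs hp ht k
  rw [add_sub_cancel, inv_inv] at h1
  refine h1.trans (ctl_mono ?_)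
  rw [le_inv_comm₀ hρ'0 (by positivity)]
  linarith

end HB

/-- For `s ∈ (0,1]`, `p > n/(n+s)` and `ρ ∈ (0,1)`: a measurable `u` lies in
`Ṁ^{s,p}_ball(Ω)` iff `inf_{g ∈ 𝒟^{s,ρ}_ball(u)} ‖g‖_{L^p(Ω)} < ∞`, and the two quantities are
comparable with a constant independent of `u`. -/
theorem stmt10 {n : ℕ} (hn : 2 ≤ n) (s p ρ : ℝ) (hs : s ∈ Set.Ioc (0:ℝ) 1)
    (hp : (n : ℝ) / (n + s) < p) (hρ : ρ ∈ Set.Ioo (0:ℝ) 1)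
    (Ω : Set (Eu n)) (hΩ : IsDomainEu Ω) :
    (∀ u : Eu n → ℝ, Measurable u →
      (MemMball Ω s p u ↔ ballNormRho Ω s p ρ u < ⊤)) ∧
    ∃ C : ℝ, 1 ≤ C ∧ ∀ u : Eu n → ℝ, MemMball Ω s p u →
      ENNReal.ofReal C⁻¹ * ballNorm Ω s p u ≤ ballNormRho Ω s p ρ u ∧
      ballNormRho Ω s p ρ u ≤ ENNReal.ofReal C * ballNorm Ω s p u := by
  have hp0 : 0 < p := by
    refine lt_of_le_of_lt ?_ hp
    have := hs.1
    positivity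
  obtain ⟨C, hC, hCu⟩ := HB.ctl_all (Ω := Ω) (p := p) (ρ := 1/2) (ρ' := ρ) hΩ.1 hs.1 hp0
    (by norm_num) (by norm_num) hρ.1 hρ.2
  obtain ⟨D, hD, hDu⟩ := HB.ctl_all (Ω := Ω) (p := p) (ρ := ρ) (ρ' := 1/2) hΩ.1 hs.1 hp0
    hρ.1 hρ.2 (by norm_num) (by norm_num)
  refine ⟨fun u hu => ⟨fun h => ?_, fun h => ⟨hu, ?_⟩⟩, max C D, le_max_of_le_left hC,
    fun u hu => ⟨?_, ?_⟩⟩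
  · exact (hCu u).trans_lt (ENNReal.mul_lt_top ENNReal.ofReal_lt_top h.2)
  · exact (hDu u).trans_lt (ENNReal.mul_lt_top ENNReal.ofReal_lt_top h)
  · have hM : 0 < max C D := lt_of_lt_of_le one_pos (le_max_of_le_left hC)
    rw [ENNReal.ofReal_inv_of_pos hM]
    refine (ENNReal.inv_mul_le_iff (ENNReal.ofReal_pos.2 hM).ne' ENNReal.ofReal_ne_top).2 ?_
    refine (hDu u).trans ?_
    gcongr
    exact le_max_right _ _
  · refine (hCu u).trans ?_
    unfold ballNorm
    gcongr
    exact le_max_left _ _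
end
end

section
/- Let n ≥ 2, s ∈ (0,1], p ∈ (n/(n+s), n/s) and σ > 1. Then there exists a constant C > 0 such that for every ball B ⊆ ℝⁿ and every u ∈ Ṁ^{s,p}(σB): ‖u − u_B‖_{L^{pn/(n−ps)}(B)} ≤ C ‖u‖_{Ṁ^{s,p}(σB)}, where u_B := (1/|B|) ∫_B u and σB is the ball concentric with B whose radius is σ times that of B. -/
open MeasureTheory Metric Set
open scoped ENNReal

noncomputable section

/-- The chaining argument, in the form of a pointwise estimate on level sets of `g`. -/
theorem chain_estimate {n : ℕ} {s σ θ δ μ K r l : ℝ} (hs : 0 < s) (hσ : 1 < σ) (hr : 0 < r)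
    (hl : 0 < l) (hθ0 : 0 < θ) (hθ1 : θ < 1) (hδ : δ = (σ - 1) * (1 - θ)) (hμ : μ = 2 * θ ^ s)
    (hK1 : 2 * (2 * σ) ^ s ≤ K) (hK2 : 3 * δ ^ s ≤ K * (μ - 1))
    (x₀ : Eu n) (u g : Eu n → ℝ) (N : Set (Eu n)) (hN : volume N = 0)
    (hg : ∀ x ∈ ball x₀ (σ * r) \ N, ∀ y ∈ ball x₀ (σ * r) \ N,
      |u x - u y| ≤ dist x y ^ s * (g x + g y))
    (hvol : ∀ (k : ℕ) (z : Eu n), volume ({x | 2 ^ k * l ≤ g x} ∩ ball x₀ (σ * r))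
      < volume (ball z (δ * r * θ ^ k))) :
    ∃ c : ℝ, ∀ k : ℕ, ∀ x ∈ ball x₀ (r + (σ - 1) * r * θ ^ k) \ N, g x ≤ 2 ^ k * l →
      |u x - c| ≤ K * r ^ s * l * μ ^ k := by
  have hδ0 : 0 < δ := by rw [hδ]; exact mul_pos (by linarith) (by linarith)
  have hδσ : δ ≤ σ := by rw [hδ]; nlinarith
  have pick : ∀ (k : ℕ) (z : Eu n), ball z (δ * r * θ ^ k) ⊆ ball x₀ (σ * r) →
      ∃ y ∈ ball z (δ * r * θ ^ k) \ N, g y ≤ 2 ^ k * l := by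
    intro k z hz
    by_contra! hcon
    have hsub : ball z (δ * r * θ ^ k) ⊆ N ∪ ({x | 2 ^ k * l ≤ g x} ∩ ball x₀ (σ * r)) := by
      intro y hy
      by_cases hyN : y ∈ N
      · exact Or.inl hyN
      · exact Or.inr ⟨(hcon y ⟨hy, hyN⟩).le, hz hy⟩
    have h1 := (measure_mono (μ := volume) hsub).trans (measure_union_le _ _)
    rw [hN, zero_add] at h1
    exact absurd (hvol k z) (not_lt.mpr h1)
  have hθk : ∀ k : ℕ, θ ^ k ≤ 1 := fun k => pow_le_one₀ hθ0.le hθ1.le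
  have hRk : ∀ k : ℕ, r + (σ - 1) * r * θ ^ k ≤ σ * r := by
    intro k
    have : (σ - 1) * r * θ ^ k ≤ (σ - 1) * r * 1 :=
      mul_le_mul_of_nonneg_left (hθk k) (mul_nonneg (by linarith) hr.le)
    nlinarith
  obtain ⟨y₀, ⟨hy₀, hy₀N⟩, hgy₀⟩ := pick 0 x₀ (ball_subset_ball (by
    simp only [pow_zero, mul_one]; exact mul_le_mul_of_nonneg_right hδσ hr.le))
  have hy₀' : y₀ ∈ ball x₀ (σ * r) := ball_subset_ball (by
    simp only [pow_zero, mul_one]; exact mul_le_mul_of_nonneg_right hδσ hr.le) hy₀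
  simp only [pow_zero, one_mul] at hgy₀
  refine ⟨u y₀, fun k => ?_⟩
  induction k with
  | zero =>
    rintro x ⟨hx, hxN⟩ hgx
    have hx' : x ∈ ball x₀ (σ * r) := ball_subset_ball (hRk 0) hx
    simp only [pow_zero, one_mul, mul_one] at hgx ⊢
    have h1 := hg x ⟨hx', hxN⟩ y₀ ⟨hy₀', hy₀N⟩
    have hd : dist x y₀ ≤ 2 * σ * r := by
      have := dist_triangle_right x y₀ x₀
      rw [mem_ball] at hx' hy₀'
      linarith
    have h2 : dist x y₀ ^ s ≤ (2 * σ) ^ s * r ^ s := by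
      rw [← Real.mul_rpow (by linarith) hr.le]
      exact Real.rpow_le_rpow dist_nonneg hd hs.le
    have h3 : 0 ≤ dist x y₀ ^ s := Real.rpow_nonneg dist_nonneg _
    have hrs : 0 < r ^ s := Real.rpow_pos_of_pos hr s
    calc |u x - u y₀| ≤ dist x y₀ ^ s * (g x + g y₀) := h1
      _ ≤ dist x y₀ ^ s * (2 * l) := mul_le_mul_of_nonneg_left (by linarith) h3
      _ ≤ (2 * σ) ^ s * r ^ s * (2 * l) := mul_le_mul_of_nonneg_right h2 (by linarith)
      _ = 2 * (2 * σ) ^ s * (r ^ s * l) := by ring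
      _ ≤ K * (r ^ s * l) := mul_le_mul_of_nonneg_right hK1 (by positivity)
      _ = K * r ^ s * l := by ring
  | succ k ih =>
    rintro x ⟨hx, hxN⟩ hgx
    have hx' : x ∈ ball x₀ (σ * r) := ball_subset_ball (hRk _) hx
    have hsub : ball x (δ * r * θ ^ k) ⊆ ball x₀ (r + (σ - 1) * r * θ ^ k) := by
      apply ball_subset_ball'
      rw [mem_ball] at hx
      have : δ * r * θ ^ k + (r + (σ - 1) * r * θ ^ (k + 1)) = r + (σ - 1) * r * θ ^ k := by
        rw [hδ]; ring
      linarith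
    obtain ⟨y, ⟨hy, hyN⟩, hgy⟩ := pick k x (hsub.trans (ball_subset_ball (hRk k)))
    have hyk := hsub hy
    have h0 := ih y ⟨hyk, hyN⟩ hgy
    have h1 := hg x ⟨hx', hxN⟩ y ⟨ball_subset_ball (hRk k) hyk, hyN⟩
    have h2 : dist x y ^ s ≤ δ ^ s * r ^ s * (θ ^ s) ^ k := by
      have e : δ ^ s * r ^ s * (θ ^ s) ^ k = (δ * r * θ ^ k) ^ s := by
        rw [Real.mul_rpow (by positivity) (by positivity), Real.mul_rpow hδ0.le hr.le,
          ← Real.rpow_natCast (θ ^ s), ← Real.rpow_natCast θ, ← Real.rpow_mul hθ0.le,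
          ← Real.rpow_mul hθ0.le, mul_comm s]
      rw [e]
      rw [mem_ball'] at hy
      exact Real.rpow_le_rpow dist_nonneg hy.le hs.le
    have h3 : 0 ≤ dist x y ^ s := Real.rpow_nonneg dist_nonneg _
    have hrs : 0 < r ^ s := Real.rpow_pos_of_pos hr s
    have hθs : 0 < θ ^ s := Real.rpow_pos_of_pos hθ0 s
    have hμ0 : 0 < μ := by rw [hμ]; positivity
    have h4 : |u x - u y| ≤ 3 * δ ^ s * (r ^ s * l * μ ^ k) := by
      calc |u x - u y| ≤ dist x y ^ s * (g x + g y) := h1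
        _ ≤ dist x y ^ s * (3 * 2 ^ k * l) := by
          apply mul_le_mul_of_nonneg_left _ h3
          rw [pow_succ] at hgx
          linarith
        _ ≤ δ ^ s * r ^ s * (θ ^ s) ^ k * (3 * 2 ^ k * l) :=
          mul_le_mul_of_nonneg_right h2 (by positivity)
        _ = _ := by rw [hμ, mul_pow]; ring
    have h5 : 3 * δ ^ s * (r ^ s * l * μ ^ k) ≤ K * (μ - 1) * (r ^ s * l * μ ^ k) :=
      mul_le_mul_of_nonneg_right hK2 (by positivity)
    calc |u x - u y₀| ≤ |u x - u y| + |u y - u y₀| := abs_sub_le _ _ _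
      _ ≤ K * (μ - 1) * (r ^ s * l * μ ^ k) + K * r ^ s * l * μ ^ k := by linarith
      _ = _ := by ring

/-- From level sets to a pointwise bound in terms of `g`. -/
theorem level_bound {l D v γ p q α : ℝ} (hl : 0 < l) (hD : 0 ≤ D) (hγ : 0 ≤ γ) (hv : 0 ≤ v)
    (hα : 0 < α) (hq : 0 < q) (hp : 0 < p) (hαq : α * q = p)
    (h : ∀ k : ℕ, γ ≤ 2 ^ k * l → v ≤ D * ((2:ℝ) ^ α) ^ k) :
    v ^ q ≤ D ^ q * 4 ^ p * (1 + (l ^ p)⁻¹ * γ ^ p) := by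
  set t := max 1 (γ / l) with ht
  have ht1 : 1 ≤ t := le_max_left _ _
  have hk : ∃ k : ℕ, t ≤ 2 ^ k ∧ (2:ℝ) ^ k ≤ 2 * t := by
    obtain ⟨k, hk1, hk2⟩ := exists_nat_pow_near ht1 (one_lt_two : (1:ℝ) < 2)
    exact ⟨k + 1, hk2.le, by rw [pow_succ]; linarith⟩
  obtain ⟨k, hk1, hk2⟩ := hk
  have h1 := h k (by
    have : γ / l ≤ 2 ^ k := (le_max_right _ _).trans hk1
    rwa [div_le_iff₀ hl] at this)
  have h2 : ((2:ℝ) ^ α) ^ k ≤ (2 * t) ^ α := by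
    rw [← Real.rpow_natCast, ← Real.rpow_mul (by norm_num), mul_comm, Real.rpow_mul (by norm_num),
      Real.rpow_natCast]
    exact Real.rpow_le_rpow (by positivity) hk2 hα.le
  have ht0 : 0 < t := by linarith
  have h3 : v ≤ D * (2 * t) ^ α := h1.trans (mul_le_mul_of_nonneg_left h2 hD)
  have h4 : v ^ q ≤ D ^ q * (2 ^ p * t ^ p) := by
    calc v ^ q ≤ (D * (2 * t) ^ α) ^ q := Real.rpow_le_rpow hv h3 hq.le
      _ = _ := by
        rw [Real.mul_rpow hD (by positivity), ← Real.rpow_mul (by positivity), hαq,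
          Real.mul_rpow (by norm_num) ht0.le]
  have h5 : t ^ p ≤ 1 + (l ^ p)⁻¹ * γ ^ p := by
    have e : (l ^ p)⁻¹ * γ ^ p = (γ / l) ^ p := by
      rw [Real.div_rpow hγ hl.le]; field_simp
    rw [e]
    have : 0 ≤ (γ / l) ^ p := by positivity
    rcases max_choice 1 (γ / l) with h | h
    · rw [ht, h, Real.one_rpow]; linarith
    · rw [ht, h]; linarith
  have h6 : (2:ℝ) ^ p ≤ 4 ^ p := Real.rpow_le_rpow (by norm_num) (by norm_num) hp.le
  calc v ^ q ≤ D ^ q * (2 ^ p * t ^ p) := h4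
    _ ≤ D ^ q * (4 ^ p * (1 + (l ^ p)⁻¹ * γ ^ p)) := by gcongr
    _ = _ := by ring

/-- Passing from an arbitrary constant to the mean value. -/
theorem mean_bound {n : ℕ} {q : ℝ} (hq : 1 < q) (x₀ : Eu n) {r : ℝ} (hr : 0 < r) (u : Eu n → ℝ)
    (hu : Measurable u) (c : ℝ) {A : ℝ≥0∞} (hA : A ≠ ⊤)
    (h : eLpNorm (fun x => u x - c) (ENNReal.ofReal q) (volume.restrict (ball x₀ r)) ≤ A) :
    eLpNorm (fun x => u x - ⨍ y in ball x₀ r, u y) (ENNReal.ofReal q)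
      (volume.restrict (ball x₀ r)) ≤ 2 * A := by
  set ν := volume.restrict (ball x₀ r) with hν
  have hν0 : ν ≠ 0 := by
    rw [hν, Ne, Measure.restrict_eq_zero]
    exact (measure_ball_pos volume x₀ hr).ne'
  have : IsFiniteMeasure ν := ⟨by rw [hν, Measure.restrict_apply_univ]; exact measure_ball_lt_top⟩
  have : NeZero ν := ⟨hν0⟩
  have hq1 : (1:ℝ≥0∞) ≤ ENNReal.ofReal q := by
    rw [← ENNReal.ofReal_one]; exact ENNReal.ofReal_le_ofReal hq.le
  have hm : MemLp (fun x => u x - c) (ENNReal.ofReal q) ν :=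
    ⟨(hu.sub_const c).aestronglyMeasurable, h.trans_lt hA.lt_top⟩
  have hi : Integrable (fun x => u x - c) ν := hm.integrable hq1
  have hiu : Integrable u ν := 
    (hi.add (integrable_const c)).congr (ae_of_all _ fun x => by simp)
  have hav : (⨍ y, u y ∂ν) - c = ⨍ y, (u y - c) ∂ν := by
    rw [average_eq, average_eq, integral_sub hiu (integrable_const c), integral_const, smul_sub,
      smul_smul, inv_mul_cancel₀, one_smul]
    rw [Measure.real, ENNReal.toReal_ne_zero]
    exact ⟨by simpa using hν0, measure_ne_top _ _⟩
  have hc : eLpNorm (fun _ => c - ⨍ y, u y ∂ν) (ENNReal.ofReal q) ν ≤ A := by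
    have hq0 : ENNReal.ofReal q ≠ 0 := (zero_lt_one.trans_le hq1).ne'
    rw [eLpNorm_const _ hq0 hν0, ENNReal.toReal_ofReal (by linarith)]
    have e1 : ‖c - ⨍ y, u y ∂ν‖ₑ ≤ (ν univ)⁻¹ * eLpNorm (fun x => u x - c) 1 ν := by
      rw [← enorm_neg, neg_sub, hav, average_eq, enorm_smul]
      gcongr
      · rw [Measure.real, ← ENNReal.toReal_inv, Real.enorm_eq_ofReal ENNReal.toReal_nonneg]
        exact ENNReal.ofReal_toReal_le
      · rw [eLpNorm_one_eq_lintegral_enorm]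
        exact enorm_integral_le_lintegral_enorm _
    have e2 := eLpNorm_le_eLpNorm_mul_rpow_measure_univ hq1
      (hu.sub_const c).aestronglyMeasurable (μ := ν)
    rw [ENNReal.toReal_one, ENNReal.toReal_ofReal (by linarith)] at e2
    have hV0 : ν univ ≠ 0 := by simpa using hν0
    have hVt : ν univ ≠ ⊤ := measure_ne_top _ _
    calc ‖c - ⨍ y, u y ∂ν‖ₑ * ν univ ^ (1 / q)
        ≤ (ν univ)⁻¹ * (A * ν univ ^ ((1:ℝ) / 1 - 1 / q)) * ν univ ^ (1 / q) := by
          gcongr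
          exact e1.trans (by gcongr; exact e2.trans (by gcongr))
      _ = A * ((ν univ)⁻¹ * (ν univ ^ ((1:ℝ) / 1 - 1 / q) * ν univ ^ (1 / q))) := by ring
      _ = A := by
        rw [← ENNReal.rpow_add _ _ hV0 hVt]
        norm_num
        rw [ENNReal.inv_mul_cancel hV0 hVt, mul_one]
  have hsum := eLpNorm_add_le (hu.sub_const c).aestronglyMeasurable
    (aestronglyMeasurable_const (b := c - ⨍ y, u y ∂ν)) hq1 (μ := ν)
  have heq : ((fun x => u x - c) + fun _ => c - ⨍ y, u y ∂ν) = fun x => u x - ⨍ y, u y ∂ν := by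
    funext x; simp
  rw [heq] at hsum
  calc _ ≤ _ := hsum
    _ ≤ A + A := add_le_add h hc
    _ = 2 * A := (two_mul A).symm

/-- The estimate for one fixed Hajłasz gradient `g` and `M > ‖g‖_p`. -/
theorem core_bound {n : ℕ} (hn : 0 < n) {s p σ α q θ δ K w : ℝ} (hs : 0 < s) (hp : 0 < p)
    (hα : 0 < α) (hq : 1 < q) (hαq : α * q = p) (hexp : s - n / p + n / q = 0)
    (hσ : 1 < σ) (hθ0 : 0 < θ) (hθ1 : θ < 1) (hθn : θ ^ n = (2 ^ p)⁻¹)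
    (hδ : δ = (σ - 1) * (1 - θ)) (hμ : (2:ℝ) ^ α = 2 * θ ^ s)
    (hK0 : 0 ≤ K) (hK1 : 2 * (2 * σ) ^ s ≤ K) (hK2 : 3 * δ ^ s ≤ K * ((2:ℝ) ^ α - 1))
    (hw : 0 < w) (hwv : volume (ball (0 : Eu n) 1) = ENNReal.ofReal w)
    (x₀ : Eu n) {r M : ℝ} (hr : 0 < r) (hM : 0 < M) (u g : Eu n → ℝ) (hu : Measurable u)
    (hg : g ∈ DFull (ball x₀ (σ * r)) s u)
    (hgM : eLpNorm g (ENNReal.ofReal p) (volume.restrict (ball x₀ (σ * r))) < ENNReal.ofReal M) :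
    eLpNorm (fun x => u x - ⨍ y in ball x₀ r, u y) (ENNReal.ofReal q)
      (volume.restrict (ball x₀ r)) ≤
      2 * ENNReal.ofReal (K * (δ ^ n * w) ^ (-(1 / p)) *
        (4 ^ p * w * (1 + δ ^ n)) ^ (1 / q) * M) := by
  obtain ⟨hgm, hg0, N, hNs, hN, hgN⟩ := hg
  have hδ0 : 0 < δ := by rw [hδ]; exact mul_pos (by linarith) (by linarith)
  have hn0 : n ≠ 0 := hn.ne'
  have hq0 : 0 < q := by linarith
  have hball : ∀ (z : Eu n) (R : ℝ), 0 < R → volume (ball z R) = ENNReal.ofReal (R ^ n * w) := by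
    intro z R hR
    rw [Measure.addHaar_ball_of_pos _ _ hR, hwv, ← ENNReal.ofReal_mul (by positivity)]
    simp
  set l : ℝ := M * (δ ^ n * w) ^ (-(1 / p)) * r ^ (-(n / p)) with hldef
  have hl : 0 < l := by positivity
  have hlp : l ^ p = M ^ p * (δ ^ n * w)⁻¹ * (r ^ n)⁻¹ := by
    rw [hldef, Real.mul_rpow (by positivity) (by positivity),
      Real.mul_rpow (by positivity) (by positivity), ← Real.rpow_mul (by positivity),
      ← Real.rpow_mul (by positivity)]
    have e1 : -(1 / p) * p = -1 := by field_simp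
    have e2 : -((n:ℝ) / p) * p = -n := by field_simp
    rw [e1, e2, Real.rpow_neg_one, Real.rpow_neg hr.le, Real.rpow_natCast]
  have hI : ∫⁻ x in ball x₀ (σ * r), ENNReal.ofReal (g x ^ p) < ENNReal.ofReal (M ^ p) := by
    rw [eLpNorm_eq_lintegral_rpow_enorm_toReal (by simpa using hp) ENNReal.ofReal_ne_top,
      ENNReal.toReal_ofReal hp.le] at hgM
    have h1 := ENNReal.rpow_lt_rpow hgM hp
    rw [← ENNReal.rpow_mul, one_div_mul_cancel hp.ne', ENNReal.rpow_one,
      ENNReal.ofReal_rpow_of_pos hM] at h1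
    refine lt_of_eq_of_lt (lintegral_congr fun x => ?_) h1
    rw [Real.enorm_eq_ofReal (hg0 x), ENNReal.ofReal_rpow_of_nonneg (hg0 x) hp.le]
  have hgpm : Measurable fun x => ENNReal.ofReal (g x ^ p) := by fun_prop
  have hvol : ∀ (k : ℕ) (z : Eu n), volume ({x | 2 ^ k * l ≤ g x} ∩ ball x₀ (σ * r))
      < volume (ball z (δ * r * θ ^ k)) := by
    intro k z
    have hmk := mul_meas_ge_le_lintegral (μ := volume.restrict (ball x₀ (σ * r))) hgpm
      (ENNReal.ofReal ((2 ^ k * l) ^ p))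
    have h2 := hmk.trans_lt hI
    have hsub : {x | 2 ^ k * l ≤ g x} ⊆
        {x | ENNReal.ofReal ((2 ^ k * l) ^ p) ≤ ENNReal.ofReal (g x ^ p)} := by
      intro x hx
      exact ENNReal.ofReal_le_ofReal (Real.rpow_le_rpow (by positivity) hx hp.le)
    rw [hball z _ (by positivity)]
    rw [Measure.restrict_apply (measurableSet_le measurable_const hgpm)] at h2
    have hpos : 0 < (2 ^ k * l) ^ p := by positivity
    have e : (2 ^ k * l) ^ p * ((δ * r * θ ^ k) ^ n * w) = M ^ p := by
      rw [Real.mul_rpow (by positivity) hl.le, hlp, mul_pow, mul_pow, ← pow_mul, mul_comm k n,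
        pow_mul, hθn, ← Real.rpow_natCast 2 k, ← Real.rpow_mul (by norm_num), mul_comm (k:ℝ) p,
        Real.rpow_mul (by norm_num), Real.rpow_natCast, inv_pow]
      field_simp
    have h3 : ENNReal.ofReal ((2 ^ k * l) ^ p) *
        volume ({x | 2 ^ k * l ≤ g x} ∩ ball x₀ (σ * r)) <
        ENNReal.ofReal ((2 ^ k * l) ^ p) * ENNReal.ofReal ((δ * r * θ ^ k) ^ n * w) := by
      rw [← ENNReal.ofReal_mul hpos.le, e]
      refine lt_of_le_of_lt ?_ h2
      gcongr
    exact lt_of_mul_lt_mul_left h3 (zero_le)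
  obtain ⟨c, hc⟩ := chain_estimate hs hσ hr hl hθ0 hθ1 hδ hμ hK1 hK2 x₀ u g N hN hgN hvol
  set D : ℝ := K * r ^ s * l with hD
  have hD0 : 0 ≤ D := by positivity
  have hpt : ∀ x ∈ ball x₀ r \ N,
      |u x - c| ^ q ≤ D ^ q * 4 ^ p * (1 + (l ^ p)⁻¹ * g x ^ p) := by
    rintro x ⟨hx, hxN⟩
    refine level_bound hl hD0 (hg0 x) (abs_nonneg _) hα hq0 hp hαq fun k hk => ?_
    refine hc k x ⟨ball_subset_ball ?_ hx, hxN⟩ hk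
    have : 0 ≤ (σ - 1) * r * θ ^ k :=
      mul_nonneg (mul_nonneg (by linarith) hr.le) (by positivity)
    linarith
  refine mean_bound hq x₀ hr u hu c ENNReal.ofReal_ne_top ?_
  have hint : ∫⁻ x in ball x₀ r, ‖u x - c‖ₑ ^ q ≤
      ENNReal.ofReal (D ^ q * (4 ^ p * w * (1 + δ ^ n)) * r ^ n) := by
    calc ∫⁻ x in ball x₀ r, ‖u x - c‖ₑ ^ q
        ≤ ∫⁻ x in ball x₀ r, ENNReal.ofReal (D ^ q * 4 ^ p) *
            (1 + ENNReal.ofReal (l ^ p)⁻¹ * ENNReal.ofReal (g x ^ p)) := by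
          refine lintegral_mono_ae ?_
          have hN' : ∀ᵐ x ∂(volume.restrict (ball x₀ r)), x ∉ N :=
            ae_restrict_of_ae (measure_eq_zero_iff_ae_notMem.mp hN)
          filter_upwards [hN', ae_restrict_mem measurableSet_ball] with x hxN hx
          have hgp : 0 ≤ g x ^ p := Real.rpow_nonneg (hg0 x) p
          rw [Real.enorm_eq_ofReal_abs, ENNReal.ofReal_rpow_of_nonneg (abs_nonneg _) hq0.le,
            ← ENNReal.ofReal_mul (by positivity), ← ENNReal.ofReal_one,
            ← ENNReal.ofReal_add (by norm_num) (by positivity),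
            ← ENNReal.ofReal_mul (by positivity)]
          exact ENNReal.ofReal_le_ofReal (hpt x ⟨hx, hxN⟩)
      _ = ENNReal.ofReal (D ^ q * 4 ^ p) * (volume (ball x₀ r) + ENNReal.ofReal (l ^ p)⁻¹ *
            ∫⁻ x in ball x₀ r, ENNReal.ofReal (g x ^ p)) := by
          rw [lintegral_const_mul _ (by fun_prop), lintegral_add_left measurable_const,
            lintegral_const_mul _ hgpm]
          simp
      _ ≤ ENNReal.ofReal (D ^ q * 4 ^ p) * (ENNReal.ofReal (r ^ n * w) +
            ENNReal.ofReal (l ^ p)⁻¹ * ENNReal.ofReal (M ^ p)) := by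
          rw [hball x₀ r hr]
          gcongr
          refine le_trans (lintegral_mono_set (ball_subset_ball ?_)) hI.le
          nlinarith
      _ = _ := by
          rw [← ENNReal.ofReal_mul (by positivity), ← ENNReal.ofReal_add (by positivity)
            (by positivity), ← ENNReal.ofReal_mul (by positivity), hlp]
          congr 1
          have : 0 < M ^ p := by positivity
          field_simp
  rw [eLpNorm_eq_lintegral_rpow_enorm_toReal (by simpa using hq0) ENNReal.ofReal_ne_top,
    ENNReal.toReal_ofReal hq0.le]
  refine (ENNReal.rpow_le_rpow hint (by positivity)).trans_eq ?_
  rw [ENNReal.ofReal_rpow_of_nonneg (by positivity) (by positivity)]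
  congr 1
  rw [Real.mul_rpow (by positivity) (by positivity), Real.mul_rpow (by positivity) (by positivity),
    ← Real.rpow_mul hD0, mul_one_div_cancel hq0.ne', Real.rpow_one, ← Real.rpow_natCast r n,
    ← Real.rpow_mul hr.le, hD, hldef]
  have hrr : r ^ s * r ^ (-((n:ℝ) / p)) * r ^ ((n:ℝ) * (1 / q)) = 1 := by
    rw [← Real.rpow_add hr, ← Real.rpow_add hr]
    have : s + -((n:ℝ) / p) + n * (1 / q) = 0 := by rw [← hexp]; ring
    rw [this, Real.rpow_zero]
  linear_combination (K * M * (δ ^ n * w) ^ (-(1 / p)) * (4 ^ p * w * (1 + δ ^ n)) ^ (1 / q)) * hrr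

/-- Hajłasz–Sobolev–Poincaré imbedding on balls: for `s ∈ (0,1]`,
`p ∈ (n/(n+s), n/s)`, `σ > 1`, there exists `C > 0` such that for all balls `B` and all
`u ∈ Ṁ^{s,p}(σB)`, `‖u - u_B‖_{L^{pn/(n-ps)}(B)} ≤ C ‖u‖_{Ṁ^{s,p}(σB)}`. -/
theorem stmt11 {n : ℕ} (hn : 2 ≤ n) (s p σ : ℝ) (hs : s ∈ Set.Ioc (0:ℝ) 1)
    (hp : (n : ℝ) / (n + s) < p) (hp' : p < (n : ℝ) / s) (hσ : 1 < σ) :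
    ∃ C : ℝ, 0 < C ∧ ∀ (x₀ : Eu n) (r : ℝ), 0 < r →
      ∀ u : Eu n → ℝ, MemMfull (ball x₀ (σ * r)) s p u →
        eLpNorm (fun x => u x - ⨍ y in ball x₀ r, u y)
            (ENNReal.ofReal (p * n / (n - p * s))) (volume.restrict (ball x₀ r))
          ≤ ENNReal.ofReal C * fullNorm (ball x₀ (σ * r)) s p u := by
  obtain ⟨hs0, hs1⟩ := hs
  have hn' : (0:ℝ) < n := by exact_mod_cast (by omega : 0 < n)
  have hp0 : 0 < p := lt_trans (by positivity) hp
  have hps : p * s < n := by rwa [lt_div_iff₀ hs0] at hp'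
  have hden : 0 < (n:ℝ) - p * s := by linarith
  set q : ℝ := p * n / (n - p * s) with hqdef
  have hq : 1 < q := by
    rw [hqdef, one_lt_div hden]
    rw [div_lt_iff₀ (by positivity)] at hp
    linarith
  set α : ℝ := 1 - p * s / n with hαdef
  have hα : 0 < α := by
    rw [hαdef, sub_pos, div_lt_one hn']; exact hps
  have hαq : α * q = p := by
    rw [hαdef, hqdef]; field_simp
  have hexp : s - n / p + n / q = 0 := by
    rw [hqdef]; field_simp; ring
  set θ : ℝ := 2 ^ (-(p / n)) with hθdef
  have hθ0 : 0 < θ := by positivity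
  have hθ1 : θ < 1 := Real.rpow_lt_one_of_one_lt_of_neg (by norm_num) (by
    rw [neg_lt_zero]; positivity)
  have hθn : θ ^ n = (2 ^ p)⁻¹ := by
    rw [hθdef, ← Real.rpow_natCast, ← Real.rpow_mul (by norm_num), ← Real.rpow_neg (by norm_num)]
    congr 1; field_simp
  have hμ : (2:ℝ) ^ α = 2 * θ ^ s := by
    rw [hθdef, ← Real.rpow_mul (by norm_num), hαdef, sub_eq_add_neg, Real.rpow_add (by norm_num),
      Real.rpow_one]
    congr 2; ring
  set δ : ℝ := (σ - 1) * (1 - θ) with hδdef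
  have hδ0 : 0 < δ := mul_pos (by linarith) (by linarith)
  have hμ1 : 0 < (2:ℝ) ^ α - 1 := sub_pos.mpr (Real.one_lt_rpow (by norm_num) hα)
  set K : ℝ := 2 * (2 * σ) ^ s + 3 * δ ^ s / ((2:ℝ) ^ α - 1) with hKdef
  have hσ0 : 0 < σ := by linarith
  have hA : 0 < 2 * (2 * σ) ^ s := by positivity
  have hB : 0 < 3 * δ ^ s / ((2:ℝ) ^ α - 1) := by positivity
  have hK1 : 2 * (2 * σ) ^ s ≤ K := by linarith
  have hK0 : 0 < K := by linarith
  have hK2 : 3 * δ ^ s ≤ K * ((2:ℝ) ^ α - 1) := by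
    rw [← div_le_iff₀ hμ1]; linarith
  set w : ℝ := (volume (ball (0 : Eu n) 1)).toReal with hwdef
  have hwv : volume (ball (0 : Eu n) 1) = ENNReal.ofReal w :=
    (ENNReal.ofReal_toReal measure_ball_lt_top.ne).symm
  have hw : 0 < w := ENNReal.toReal_pos (measure_ball_pos volume _ one_pos).ne'
    measure_ball_lt_top.ne
  set C₀ : ℝ := K * (δ ^ n * w) ^ (-(1 / p)) * (4 ^ p * w * (1 + δ ^ n)) ^ (1 / q) with hC₀
  have hC₀pos : 0 < C₀ := by positivity
  refine ⟨2 * C₀, by positivity, fun x₀ r hr u hu => ?_⟩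
  obtain ⟨hum, hfin⟩ := hu
  have hstep : ∀ M : ℝ, 0 < M → fullNorm (ball x₀ (σ * r)) s p u < ENNReal.ofReal M →
      eLpNorm (fun x => u x - ⨍ y in ball x₀ r, u y) (ENNReal.ofReal q)
        (volume.restrict (ball x₀ r)) ≤ ENNReal.ofReal (2 * C₀) * ENNReal.ofReal M := by
    intro M hM hlt
    simp only [fullNorm, iInf_lt_iff] at hlt
    obtain ⟨g, hg, hgM⟩ := hlt
    have := core_bound (by omega) hs0 hp0 hα hq hαq hexp hσ hθ0 hθ1 hθn hδdef hμ hK0.le hK1 hK2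
      hw hwv x₀ hr hM u g hum hg hgM
    refine this.trans_eq ?_
    rw [← hC₀, ENNReal.ofReal_mul hC₀pos.le, ENNReal.ofReal_mul (p := 2) (by norm_num), mul_assoc,
      ENNReal.ofReal_ofNat]
  have hC0 : ENNReal.ofReal (2 * C₀) ≠ 0 := by simpa using hC₀pos
  rw [mul_comm, ← ENNReal.div_le_iff hC0 ENNReal.ofReal_ne_top]
  refine le_of_forall_gt_imp_ge_of_dense fun a ha => ?_
  rcases eq_or_ne a ⊤ with rfl | hat
  · exact le_top
  rw [ENNReal.div_le_iff hC0 ENNReal.ofReal_ne_top, mul_comm]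
  have ha0 : 0 < a.toReal := ENNReal.toReal_pos (lt_of_le_of_lt zero_le ha).ne' hat
  have := hstep a.toReal ha0 (by rwa [ENNReal.ofReal_toReal hat])
  rwa [ENNReal.ofReal_toReal hat] at this
end
end
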